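/- arXiv:2209.08806 — 4 statements merged into one kernel-verified Lean document; each statement's English description precedes it below -/
import Mathlib

section
/- Gradient bound for the smoothed solution of the multivariate normal Stein equation: let h : ℝ^k → ℝ be bounded and measurable. For 0 < s < 1 define h_s(w) = ∫_{ℝ^k} h(s^{1/2}y + (1−s)^{1/2}w) φ(y) dy, and for 0 < t < 1 define ψ_t(w) = −∫_t^1 (1/(2(1−s))) (h_s(w) − E[h(N)]) ds. Then ψ_t is differentiable, and for every w ∈ ℝ^k, every j ∈ {1,…,k}, and every 0 < t < 1, |∂_j ψ_t(w)| ≤ √(π/2) · sup_{x ∈ ℝ^k} |h(x) − E[h(N)]|. -/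
open MeasureTheory Real Filter

noncomputable section

/-- The standard Gaussian measure N(0, I_k) on ℝ^k. -/
def stdGaussian (k : ℕ) : Measure (EuclideanSpace ℝ (Fin k)) :=
  volume.withDensity fun w => ENNReal.ofReal ((2 * π) ^ (-(k : ℝ) / 2) * Real.exp (-‖w‖ ^ 2 / 2))

local notation "EE" k => EuclideanSpace ℝ (Fin k)

def phi (k : ℕ) (w : EE k) : ℝ := (2 * π) ^ (-(k : ℝ) / 2) * Real.exp (-‖w‖ ^ 2 / 2)

lemma phi_nonneg (k : ℕ) (w : EE k) : 0 ≤ phi k w := by unfold phi; positivity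

lemma phi_cont (k : ℕ) : Continuous (phi k) := by unfold phi; fun_prop

instance sfin (k : ℕ) : SFinite (stdGaussian k) := by unfold stdGaussian; infer_instance

lemma integral_std {F : Type*} [NormedAddCommGroup F] [NormedSpace ℝ F] (k : ℕ) (f : (EE k) → F) :
    ∫ y, f y ∂(stdGaussian k) = ∫ y, phi k y • f y := by
  unfold stdGaussian
  rw [integral_withDensity_eq_integral_toReal_smul]
  · congr 1; ext y; rw [ENNReal.toReal_ofReal (by positivity)]; rfl
  · exact (phi_cont k).measurable.ennreal_ofReal
  · simp

lemma integrable_std {F : Type*} [NormedAddCommGroup F] [NormedSpace ℝ F] (k : ℕ) (f : (EE k) → F) :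
    Integrable f (stdGaussian k) ↔ Integrable (fun y => phi k y • f y) := by
  unfold stdGaussian
  rw [integrable_withDensity_iff_integrable_smul']
  · have : (fun y : EE k => (ENNReal.ofReal ((2 * π) ^ (-(k : ℝ) / 2) * Real.exp (-‖y‖ ^ 2 / 2))).toReal • f y)
        = fun y => phi k y • f y := by
      ext y; rw [ENNReal.toReal_ofReal (by positivity)]; rfl
    rw [this]
  · exact (phi_cont k).measurable.ennreal_ofReal
  · simp

lemma integrable_gexp (k : ℕ) {b : ℝ} (hb : 0 < b) :
    Integrable (fun v : EE k => Real.exp (-b * ‖v‖ ^ 2)) := by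
  have := (GaussianFourier.integrable_cexp_neg_mul_sq_norm_add (V := EE k) (b := (b : ℂ)) (by simpa using hb) 0 0).norm
  refine this.congr (Eventually.of_forall fun v => ?_)
  simp only [Complex.norm_exp]
  congr 1
  simp [← Complex.ofReal_pow]

lemma integral_phi (k : ℕ) : ∫ y, phi k y = 1 := by
  unfold phi
  rw [integral_const_mul]
  have := GaussianFourier.integral_rexp_neg_mul_sq_norm (V := EE k) (b := 1/2) (by norm_num)
  have e : ∀ y : EE k, -‖y‖ ^ 2 / 2 = -(1/2) * ‖y‖ ^ 2 := fun y => by ring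
  simp_rw [e, this, finrank_euclideanSpace_fin]
  rw [show π / (1/2) = 2 * π by ring, ← Real.rpow_add (by positivity)]
  rw [show -(k:ℝ)/2 + k/2 = 0 by ring, Real.rpow_zero]

lemma integrable_phi (k : ℕ) : Integrable (phi k) := by
  by_contra h
  have := integral_phi k
  rw [integral_undef h] at this
  norm_num at this

instance prob (k : ℕ) : IsProbabilityMeasure (stdGaussian k) := by
  have hfin : Integrable (fun _ => (1:ℝ)) (stdGaussian k) := by
    rw [integrable_std]; simpa using integrable_phi k
  have h1 : IsFiniteMeasure (stdGaussian k) := by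
    rw [integrable_const_iff] at hfin
    simpa using hfin
  constructor
  have : ∫ y, (1:ℝ) ∂(stdGaussian k) = 1 := by
    rw [integral_std]; simpa using integral_phi k
  rw [integral_const, smul_eq_mul, mul_one, Measure.real] at this
  rw [← ENNReal.toReal_eq_one_iff]
  exact this

lemma x_exp (x : ℝ) : x * Real.exp (-x ^ 2 / 2) ≤ Real.exp (-x ^ 2 / 4) := by
  have h1 : x ≤ Real.exp (x ^ 2 / 4) := by
    have := Real.add_one_le_exp (x ^ 2 / 4)
    nlinarith [sq_nonneg (x / 2 - 1)]
  calc x * Real.exp (-x ^ 2 / 2) ≤ Real.exp (x ^ 2 / 4) * Real.exp (-x ^ 2 / 2) := by gcongr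
    _ = _ := by rw [← Real.exp_add]; congr 1; ring

lemma integrable_norm_std (k : ℕ) : Integrable (fun y => ‖y‖) (stdGaussian k) := by
  rw [integrable_std]
  refine ((integrable_gexp k (b := 1/4) (by norm_num)).const_mul ((2 * π) ^ (-(k : ℝ) / 2))).mono'
    ((phi_cont k).smul continuous_norm).aestronglyMeasurable (Eventually.of_forall fun y => ?_)
  rw [Real.norm_of_nonneg (by have := phi_nonneg k y; positivity)]
  unfold phi
  rw [smul_eq_mul, mul_assoc]
  have := x_exp ‖y‖
  rw [mul_comm (rexp _), show -(1/4) * ‖y‖^2 = -‖y‖^2/4 by ring]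
  gcongr

lemma abs1 : ∫ x : ℝ, |x| * Real.exp (-x ^ 2 / 2) = 2 := by
  have := integral_comp_abs (f := fun x : ℝ => x * Real.exp (-x ^ 2 / 2))
  simp only [sq_abs] at this
  rw [this]
  have h2 := integral_mul_cexp_neg_mul_sq (b := (1/2 : ℂ)) (by norm_num)
  have h3 : ∫ r in Set.Ioi (0:ℝ), r * Real.exp (-r ^ 2 / 2) = 1 := by
    rw [← Complex.ofReal_inj, ← integral_complex_ofReal]
    simp only [Complex.ofReal_mul, Complex.ofReal_exp, Complex.ofReal_div, Complex.ofReal_neg, Complex.ofReal_pow, Complex.ofReal_ofNat, Complex.ofReal_one]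
    convert h2 using 1
    · congr 1; ext r; congr 2; ring
    · norm_num
  rw [h3]; norm_num

lemma gauss1 : ∫ x : ℝ, Real.exp (-x ^ 2 / 2) = √(2 * π) := by
  have := integral_gaussian (1/2)
  rw [show π / (1/2) = 2 * π by ring] at this
  rw [← this]; congr 1; ext x; congr 1; ring

lemma phi_prod (k : ℕ) (y : Fin k → ℝ) :
    phi k (WithLp.toLp 2 y) = ∏ i, ((√(2 * π))⁻¹ * Real.exp (-(y i) ^ 2 / 2)) := by
  unfold phi
  rw [Finset.prod_mul_distrib, ← Real.exp_sum, EuclideanSpace.norm_sq_eq]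
  simp only [Finset.prod_const, Finset.card_univ, Fintype.card_fin]
  congr 1
  · rw [Real.sqrt_eq_rpow, ← Real.rpow_neg (by positivity), ← Real.rpow_natCast, ← Real.rpow_mul (by positivity)]
    congr 1; ring
  · simp [Finset.sum_div, neg_div]

lemma abs_coord (k : ℕ) (j : Fin k) : ∫ y, |y j| ∂(stdGaussian k) = √(2 / π) := by
  rw [integral_std, ← (PiLp.volume_preserving_toLp (Fin k)).integral_comp
    (MeasurableEquiv.toLp 2 (Fin k → ℝ)).measurableEmbedding]
  have : ∀ y : Fin k → ℝ, phi k (WithLp.toLp 2 y) • |y j| =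
      ∏ i, ((√(2 * π))⁻¹ * ((if i = j then |y i| else 1) * Real.exp (-(y i) ^ 2 / 2))) := by
    intro y
    rw [phi_prod, smul_eq_mul]
    simp only [Finset.prod_mul_distrib]
    simp
    ring
  simp only [this]
  rw [integral_fintype_prod_volume_eq_prod
    (fun i x => (√(2 * π))⁻¹ * ((if i = j then |x| else 1) * Real.exp (-x ^ 2 / 2)))]
  rw [Finset.prod_eq_single j]
  · simp only [if_true]
    rw [integral_const_mul, abs1, inv_mul_eq_div, eq_comm, Real.sqrt_eq_iff_mul_self_eq (by positivity) (by positivity)]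
    field_simp
    rw [Real.sq_sqrt (by positivity)]
  · intro i _ hij
    simp only [hij, if_false, one_mul]
    rw [integral_const_mul, gauss1, inv_mul_cancel₀ (by positivity)]
  · simp

lemma phi_deriv (k : ℕ) (z u : EE k) :
    HasFDerivAt (fun u => phi k (z - u)) (phi k (z - u) • innerSL ℝ (z - u)) u := by
  unfold phi
  have h1 : HasFDerivAt (fun u : EE k => z - u) (-(ContinuousLinearMap.id ℝ (EE k))) u :=
    (hasFDerivAt_id u).const_sub z
  have h2 := h1.norm_sq
  have h3 := ((h2.neg.mul_const (1/2 : ℝ)).exp).const_mul ((2 * π) ^ (-(k : ℝ) / 2))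
  have e : ∀ y : ℝ, Real.exp (-y / 2) = Real.exp (-y * (1/2)) := fun y => by congr 1; ring
  simp only [e]
  refine HasFDerivAt.congr_fderiv (f := fun u => (2 * π) ^ (-(k : ℝ) / 2) * Real.exp (-‖z - u‖ ^ 2 * (1/2))) h3 ?_
  ext v
  simp
  ring

lemma deriv_conv (k : ℕ) (q : (EE k) → ℝ) (hq : Measurable q) (M : ℝ) (hM : ∀ x, |q x| ≤ M) (u₀ : EE k) :
    HasFDerivAt (fun u => ∫ y, q (y + u) ∂(stdGaussian k))
      (∫ y, q (y + u₀) • innerSL ℝ y ∂(stdGaussian k)) u₀ := by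
  have hM0 : 0 ≤ M := (abs_nonneg _).trans (hM 0)
  have e1 : ∀ u, ∫ y, q (y + u) ∂(stdGaussian k) = ∫ z, phi k (z - u) * q z := by
    intro u
    rw [integral_std, ← integral_add_right_eq_self (fun z => phi k (z - u) * q z) u]
    simp
  have e2 : ∀ u, ∫ y, q (y + u) • innerSL ℝ y ∂(stdGaussian k)
      = ∫ z, q z • phi k (z - u) • innerSL ℝ (z - u) := by
    intro u
    rw [integral_std, ← integral_add_right_eq_self (fun z => q z • phi k (z - u) • innerSL ℝ (z - u)) u]
    simp only [add_sub_cancel_right]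
    congr 1; ext1 y; rw [smul_comm]
  rw [e2]
  simp only [e1]
  have m1 : ∀ u, AEStronglyMeasurable (fun z => phi k (z - u) * q z) volume := fun u =>
    (((phi_cont k).comp (continuous_id.sub continuous_const)).measurable.mul hq).aestronglyMeasurable
  refine hasFDerivAt_integral_of_dominated_of_fderiv_le
    (F' := fun u z => q z • phi k (z - u) • innerSL ℝ (z - u))
    (bound := fun z => M * ((2 * π) ^ (-(k : ℝ) / 2) * (Real.exp (1/4) * Real.exp (-(1/8) * ‖z - u₀‖ ^ 2))))
    (Metric.ball_mem_nhds u₀ one_pos)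
    (Eventually.of_forall m1) ?_ ?_ ?_ ?_ ?_
  · refine (((integrable_phi k).comp_sub_right u₀).mul_const M).mono' (m1 _) (Eventually.of_forall fun z => ?_)
    rw [norm_mul, Real.norm_of_nonneg (phi_nonneg _ _)]
    exact mul_le_mul_of_nonneg_left (hM z) (phi_nonneg _ _)
  · refine hq.aestronglyMeasurable.smul (Continuous.aestronglyMeasurable ?_)
    exact ((phi_cont k).comp (continuous_id.sub continuous_const)).smul
      ((innerSL ℝ).continuous.comp (continuous_id.sub continuous_const))
  · refine Eventually.of_forall fun z u hu => ?_
    rw [norm_smul, norm_smul, Real.norm_of_nonneg (phi_nonneg _ _), innerSL_apply_norm]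
    refine mul_le_mul (hM z) ?_ (by have := phi_nonneg k (z-u); positivity) hM0
    unfold phi
    rw [mul_assoc]
    refine mul_le_mul_of_nonneg_left ?_ (by positivity)
    rw [mul_comm]
    refine (x_exp _).trans ?_
    rw [← Real.exp_add, Real.exp_le_exp]
    have h1 : ‖z - u₀‖ ≤ ‖z - u‖ + 1 := by
      have : z - u₀ = (z - u) + (u - u₀) := by abel
      rw [this]
      refine (norm_add_le _ _).trans ?_
      have := mem_ball_iff_norm.1 hu
      linarith
    have h2 := norm_nonneg (z - u₀)
    nlinarith [sq_nonneg (‖z - u‖ - 1), mul_self_le_mul_self h2 h1]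
  · exact ((((integrable_gexp k (b := 1/8) (by norm_num)).comp_sub_right u₀).const_mul _).const_mul _).const_mul _
  · refine Eventually.of_forall fun z u hu => ?_
    have := (phi_deriv k z u).mul_const (q z)
    exact this

lemma deriv_ab (k : ℕ) (g : (EE k) → ℝ) (hg : Measurable g) (M : ℝ) (hM : ∀ x, |g x| ≤ M)
    (a b : ℝ) (hb : 0 < b) (w : EE k) :
    HasFDerivAt (fun w => ∫ y, g (b • y + a • w) ∂(stdGaussian k))
      ((a / b) • ∫ y, g (b • y + a • w) • innerSL ℝ y ∂(stdGaussian k)) w := by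
  have h1 := deriv_conv k (fun z => g (b • z)) (hg.comp (measurable_const_smul b)) M (fun x => hM _) ((a / b) • w)
  have h2 : HasFDerivAt (fun w : EE k => (a / b) • w) ((a / b) • ContinuousLinearMap.id ℝ (EE k)) w :=
    ((a / b) • ContinuousLinearMap.id ℝ (EE k)).hasFDerivAt
  have h3 := h1.comp w h2
  have e : ∀ y w : EE k, b • (y + (a / b) • w) = b • y + a • w := fun y w => by
    rw [smul_add, smul_smul, mul_div_cancel₀ _ hb.ne']
  simp only [Function.comp_def, e] at h3
  refine h3.congr_fderiv ?_
  ext v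
  simp

def cc (s : ℝ) : ℝ := 1 / (2 * (1 - s)) * (√(1 - s) / √s)

lemma cc_deriv (s : ℝ) (h0 : 0 < s) (h1 : s < 1) :
    HasDerivAt (fun s => Real.arcsin (√s)) (cc s) s := by
  have hs1 : √s < 1 := by rw [Real.sqrt_lt' one_pos]; simpa using h1
  have hs0 : 0 < √s := Real.sqrt_pos.2 h0
  have hq : 0 < √(1 - s) := Real.sqrt_pos.2 (by linarith)
  have := (Real.hasDerivAt_arcsin (by linarith) hs1.ne).comp s (Real.hasDerivAt_sqrt h0.ne')
  refine this.congr_deriv ?_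
  unfold cc
  rw [Real.sq_sqrt h0.le]
  have e : 1 - s = √(1 - s) ^ 2 := (Real.sq_sqrt (by linarith)).symm
  have e2 : 1 / (2 * (1 - s)) = 1 / (2 * √(1 - s) ^ 2) := by rw [← e]
  rw [e2]
  field_simp

lemma cc_nonneg (s : ℝ) (h1 : s ≤ 1) : 0 ≤ cc s := by
  unfold cc
  have : 0 ≤ 1 - s := by linarith
  positivity

lemma cc_int (t : ℝ) (h0 : 0 < t) : IntegrableOn cc (Set.Ioc t 1) :=
  intervalIntegral.integrableOn_deriv_of_nonneg (g := fun s => Real.arcsin (√s))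
    (Real.continuous_arcsin.comp Real.continuous_sqrt).continuousOn
    (fun x hx => cc_deriv x (h0.trans hx.1) hx.2) (fun x hx => cc_nonneg x hx.2.le)

lemma cc_integral (t : ℝ) (h0 : 0 < t) (h1 : t < 1) : ∫ s in Set.Ioc t 1, cc s ≤ π / 2 := by
  rw [← intervalIntegral.integral_of_le h1.le,
    intervalIntegral.integral_eq_sub_of_hasDerivAt_of_le (f := fun s => Real.arcsin (√s)) h1.le
    (Real.continuous_arcsin.comp Real.continuous_sqrt).continuousOn
    (fun x hx => cc_deriv x (h0.trans hx.1) hx.2)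
    ((intervalIntegrable_iff_integrableOn_Ioc_of_le h1.le).2 (cc_int t h0))]
  have : 0 ≤ Real.arcsin (√t) := Real.arcsin_nonneg.2 (Real.sqrt_nonneg _)
  simp

section core
variable (k : ℕ) (g : (EE k) → ℝ)

def II (w : EE k) (s : ℝ) : ℝ := ∫ y, g (√s • y + √(1 - s) • w) ∂(stdGaussian k)
def JJ (w : EE k) (s : ℝ) : (EE k) →L[ℝ] ℝ :=
  ∫ y, g (√s • y + √(1 - s) • w) • innerSL ℝ y ∂(stdGaussian k)

lemma joint (hg : Measurable g) (w : EE k) :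
    Measurable (fun p : ℝ × (EE k) => g (√p.1 • p.2 + √(1 - p.1) • w)) := by
  refine hg.comp (Continuous.measurable ?_)
  fun_prop

lemma II_meas (hg : Measurable g) (w : EE k) : StronglyMeasurable (II k g w) :=
  StronglyMeasurable.integral_prod_right (f := fun s y => g (√s • y + √(1 - s) • w))
    (joint k g hg w).stronglyMeasurable

lemma JJ_meas (hg : Measurable g) (w : EE k) : StronglyMeasurable (JJ k g w) :=
  StronglyMeasurable.integral_prod_right
    (f := fun s (y : EE k) => g (√s • y + √(1 - s) • w) • innerSL ℝ y)
    ((joint k g hg w).stronglyMeasurable.smul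
      ((innerSL ℝ).continuous.comp continuous_snd).stronglyMeasurable)

lemma JJ_norm (M : ℝ) (hM : ∀ x, |g x| ≤ M) (w : EE k) (s : ℝ) :
    ‖JJ k g w s‖ ≤ M * ∫ y, ‖y‖ ∂(stdGaussian k) := by
  rw [← integral_const_mul]
  refine norm_integral_le_of_norm_le ((integrable_norm_std k).const_mul M) (Eventually.of_forall fun y => ?_)
  rw [norm_smul, innerSL_apply_norm]
  exact mul_le_mul_of_nonneg_right (hM _) (norm_nonneg _)

lemma JJ_coord (hg : Measurable g) (M : ℝ) (hM : ∀ x, |g x| ≤ M) (w : EE k) (s : ℝ) (j : Fin k) :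
    |JJ k g w s (EuclideanSpace.single j 1)| ≤ M * √(2 / π) := by
  unfold JJ
  have hm : AEStronglyMeasurable (fun y : EE k => g (√s • y + √(1 - s) • w) • innerSL ℝ y) (stdGaussian k) :=
    (((joint k g hg w).comp (measurable_prodMk_left (x := s))).stronglyMeasurable.smul
      ((innerSL ℝ).continuous).stronglyMeasurable).aestronglyMeasurable
  rw [ContinuousLinearMap.integral_apply, ← abs_coord k j, ← integral_const_mul]
  · rw [← Real.norm_eq_abs]
    refine norm_integral_le_of_norm_le (Integrable.const_mul ?_ M) (Eventually.of_forall fun y => ?_)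
    · refine (integrable_norm_std k).mono' (by fun_prop) (Eventually.of_forall fun y => ?_)
      rw [Real.norm_eq_abs, abs_abs]
      exact PiLp.norm_apply_le y j
    · have : (g (√s • y + √(1 - s) • w) • innerSL ℝ y) (EuclideanSpace.single j (1:ℝ))
          = g (√s • y + √(1 - s) • w) * y j := by
        simp [EuclideanSpace.inner_single_right]
      rw [this, norm_mul]
      exact mul_le_mul_of_nonneg_right (hM _) (norm_nonneg _)
  · refine ((integrable_norm_std k).const_mul M).mono' hm (Eventually.of_forall fun y => ?_)
    rw [norm_smul, innerSL_apply_norm]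
    exact mul_le_mul_of_nonneg_right (hM _) (norm_nonneg _)

lemma core_diff (hg : Measurable g) (M : ℝ) (hM : ∀ x, |g x| ≤ M) (s : ℝ) (h0 : 0 < s) (w : EE k) :
    HasFDerivAt (fun w => 1 / (2 * (1 - s)) * II k g w s) (cc s • JJ k g w s) w := by
  have := (deriv_ab k g hg M hM (√(1 - s)) (√s) (Real.sqrt_pos.2 h0) w).const_mul (1 / (2 * (1 - s)))
  rw [smul_smul] at this
  exact this

lemma cc_meas : Measurable cc := by unfold cc; fun_prop

lemma core_bound (M : ℝ) (hM : ∀ x, |g x| ≤ M) (s : ℝ) (h1 : s ≤ 1) (w : EE k) :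
    ‖cc s • JJ k g w s‖ ≤ cc s * (M * ∫ y, ‖y‖ ∂(stdGaussian k)) := by
  rw [norm_smul, Real.norm_of_nonneg (cc_nonneg s h1)]
  exact mul_le_mul_of_nonneg_left (JJ_norm k g M hM w s) (cc_nonneg s h1)

lemma FF_meas (hg : Measurable g) (w : EE k) :
    Measurable (fun s => 1 / (2 * (1 - s)) * II k g w s) := by
  have := (II_meas k g hg w).measurable
  fun_prop

lemma core_deriv (hg : Measurable g) (M : ℝ) (hM : ∀ x, |g x| ≤ M) (t : ℝ) (h0 : 0 < t) (w : EE k)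
    (hi : IntegrableOn (fun s => 1 / (2 * (1 - s)) * II k g w s) (Set.Ioc t 1)) :
    HasFDerivAt (fun w => ∫ s in Set.Ioc t 1, 1 / (2 * (1 - s)) * II k g w s)
      (∫ s in Set.Ioc t 1, cc s • JJ k g w s) w := by
  refine hasFDerivAt_integral_of_dominated_of_fderiv_le
    (F := fun w s => 1 / (2 * (1 - s)) * II k g w s)
    (F' := fun w s => cc s • JJ k g w s)
    (bound := fun s => cc s * (M * ∫ y, ‖y‖ ∂(stdGaussian k))) (Filter.univ_mem)
    (Eventually.of_forall fun w => (FF_meas k g hg w).aestronglyMeasurable) hi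
    (cc_meas.stronglyMeasurable.smul (JJ_meas k g hg w)).aestronglyMeasurable ?_
    ((cc_int t h0).mul_const _) ?_
  · exact (ae_restrict_mem measurableSet_Ioc).mono fun s hs w _ => core_bound k g M hM s hs.2 w
  · exact (ae_restrict_mem measurableSet_Ioc).mono fun s hs w _ =>
      core_diff k g hg M hM s (h0.trans hs.1) w

lemma core_transfer (hg : Measurable g) (M : ℝ) (hM : ∀ x, |g x| ≤ M) (t : ℝ) (h0 : 0 < t) (w v : EE k)
    (hi : IntegrableOn (fun s => 1 / (2 * (1 - s)) * II k g w s) (Set.Ioc t 1)) :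
    IntegrableOn (fun s => 1 / (2 * (1 - s)) * II k g v s) (Set.Ioc t 1) := by
  have hd : IntegrableOn (fun s => 1 / (2 * (1 - s)) * II k g v s - 1 / (2 * (1 - s)) * II k g w s)
      (Set.Ioc t 1) := by
    refine ((cc_int t h0).mul_const ((M * ∫ y, ‖y‖ ∂(stdGaussian k)) * ‖v - w‖)).mono'
      ((FF_meas k g hg v).sub (FF_meas k g hg w)).aestronglyMeasurable ?_
    refine (ae_restrict_mem measurableSet_Ioc).mono fun s hs => ?_
    rw [← mul_assoc]
    exact Convex.norm_image_sub_le_of_norm_hasFDerivWithin_le (𝕜 := ℝ)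
      (f := fun w => 1 / (2 * (1 - s)) * II k g w s)
      (fun x _ => (core_diff k g hg M hM s (h0.trans hs.1) x).hasFDerivWithinAt)
      (fun x _ => core_bound k g M hM s hs.2 x) convex_univ (Set.mem_univ w) (Set.mem_univ v)
  refine (hd.add hi).congr (Eventually.of_forall fun s => ?_)
  simp

lemma core_final (hg : Measurable g) (M : ℝ) (hM : ∀ x, |g x| ≤ M) (t : ℝ) (h0 : 0 < t) (h1 : t < 1)
    (ψ : (EE k) → ℝ) (hψ : ∀ w, ψ w = -∫ s in Set.Ioc t 1, 1 / (2 * (1 - s)) * II k g w s) :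
    Differentiable ℝ ψ ∧ ∀ (w : EE k) (j : Fin k),
      |fderiv ℝ ψ w (EuclideanSpace.single j 1)| ≤ √(π / 2) * M := by
  have hM0 : 0 ≤ M := (abs_nonneg _).trans (hM 0)
  have hψ' := funext hψ
  by_cases hi : IntegrableOn (fun s => 1 / (2 * (1 - s)) * II k g 0 s) (Set.Ioc t 1)
  · have hd : ∀ w, HasFDerivAt ψ (-∫ s in Set.Ioc t 1, cc s • JJ k g w s) w := fun w => by
      rw [hψ']
      exact (core_deriv k g hg M hM t h0 w (core_transfer k g hg M hM t h0 0 w hi)).neg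
    refine ⟨fun w => (hd w).differentiableAt, fun w j => ?_⟩
    rw [(hd w).fderiv]
    rw [ContinuousLinearMap.neg_apply, abs_neg, ContinuousLinearMap.integral_apply]
    · calc |∫ s in Set.Ioc t 1, (cc s • JJ k g w s) (EuclideanSpace.single j 1)|
          ≤ ∫ s in Set.Ioc t 1, cc s * (M * √(2 / π)) := by
            rw [← Real.norm_eq_abs]
            refine norm_integral_le_of_norm_le ((cc_int t h0).mul_const _) ?_
            refine (ae_restrict_mem measurableSet_Ioc).mono fun s hs => ?_
            rw [ContinuousLinearMap.smul_apply, norm_smul, Real.norm_of_nonneg (cc_nonneg s hs.2)]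
            exact mul_le_mul_of_nonneg_left (JJ_coord k g hg M hM w s j) (cc_nonneg s hs.2)
        _ = (∫ s in Set.Ioc t 1, cc s) * (M * √(2 / π)) := integral_mul_const _ _
        _ ≤ (π / 2) * (M * √(2 / π)) := by
            gcongr
            exact cc_integral t h0 h1
        _ = √(π / 2) * M := by
            have : (π / 2) * √(2 / π) = √(π / 2) := by
              rw [eq_comm, Real.sqrt_eq_iff_mul_self_eq (by positivity) (by positivity)]
              rw [show π / 2 * √(2 / π) * (π / 2 * √(2 / π)) = (π / 2) * (π / 2) * (√(2 / π) * √(2 / π)) by ring,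
                Real.mul_self_sqrt (by positivity)]
              field_simp
            rw [← this]; ring
    · refine ((cc_int t h0).mul_const (M * ∫ y, ‖y‖ ∂(stdGaussian k))).mono'
        (cc_meas.stronglyMeasurable.smul (JJ_meas k g hg w)).aestronglyMeasurable ?_
      exact (ae_restrict_mem measurableSet_Ioc).mono fun s hs => core_bound k g M hM s hs.2 w
  · have : ψ = fun _ => 0 := by
      ext w
      rw [hψ, integral_undef, neg_zero]
      exact fun hw => hi (core_transfer k g hg M hM t h0 w 0 hw)
    rw [this]
    refine ⟨differentiable_const _, fun w j => ?_⟩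
    simp
    positivity

end core

/-- Gradient bound for the smoothed solution of the multivariate
normal Stein equation: for bounded measurable `h`, with
`h_s(w) = ∫ h(s^{1/2}y + (1−s)^{1/2}w) φ(y) dy` and
`ψ_t(w) = −∫_t^1 (1/(2(1−s))) (h_s(w) − E[h(N)]) ds`, for every `0 < t < 1` the
function `ψ_t` is differentiable and
`|∂_j ψ_t(w)| ≤ √(π/2) · sup_x |h(x) − E[h(N)]|`. -/
theorem smoothed_stein_solution_gradient_bound
    (k : ℕ) (hk : 1 ≤ k)
    (h : EuclideanSpace ℝ (Fin k) → ℝ)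
    (hmeas : Measurable h) (hbdd : ∃ C : ℝ, ∀ x, |h x| ≤ C)
    -- h_s(w) = ∫ h(s^{1/2}y + (1−s)^{1/2}w) φ(y) dy
    (hs : ℝ → EuclideanSpace ℝ (Fin k) → ℝ)
    (hhs : ∀ s w, hs s w =
      ∫ y, h (Real.sqrt s • y + Real.sqrt (1 - s) • w) ∂(stdGaussian k))
    -- ψ_t(w) = −∫_t^1 (1/(2(1−s))) (h_s(w) − E[h(N)]) ds
    (ψ : ℝ → EuclideanSpace ℝ (Fin k) → ℝ)
    (hψ : ∀ t w, ψ t w =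
      -∫ s in t..1, (1 / (2 * (1 - s))) * (hs s w - ∫ y, h y ∂(stdGaussian k))) :
    ∀ t : ℝ, 0 < t → t < 1 →
      Differentiable ℝ (ψ t) ∧
      ∀ (w : EuclideanSpace ℝ (Fin k)) (j : Fin k),
        |fderiv ℝ (ψ t) w (EuclideanSpace.single j 1)| ≤
          Real.sqrt (π / 2) * ⨆ x, |h x - ∫ y, h y ∂(stdGaussian k)| := by
  intro t h0 h1
  obtain ⟨C, hC⟩ := hbdd
  set m := ∫ y, h y ∂(stdGaussian k) with hm
  have hb : BddAbove (Set.range fun x => |h x - m|) := by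
    refine ⟨C + |m|, ?_⟩
    rintro _ ⟨x, rfl⟩
    exact (abs_sub _ _).trans (add_le_add (hC x) le_rfl)
  refine core_final k (fun x => h x - m) (hmeas.sub_const m) _ (fun x => le_ciSup hb x) t h0 h1 (ψ t) ?_
  intro w
  rw [hψ, intervalIntegral.integral_of_le h1.le]
  congr 2
  ext s
  congr 1
  unfold II
  rw [integral_sub, integral_const, hhs]
  · simp
  · refine (integrable_const C).mono' ?_ (Eventually.of_forall fun y => hC _)
    exact (hmeas.comp (Continuous.measurable (by fun_prop))).aestronglyMeasurable
  · exact integrable_const _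
end
end

section
/- Total variation bound for the Poisson posterior with gamma prior: let n ≥ 1 be an integer, τ₁, τ₂ > 0 and s ≥ 0. Define λ(w) = −τ₁w + (n+τ₂)e^w, and let θ be a random variable on ℝ with probability density p(w) = κ exp(ws − λ(w)) (κ > 0 the normalising constant); equivalently, e^θ has a Gamma(τ₁+s, n+τ₂) distribution. Let θ̃ = log((τ₁+s)/(n+τ₂)) (so λ'(θ̃) = s and λ''(θ̃) = τ₁+s), set θ* = √(τ₁+s)·(θ − θ̃), and let N ~ N(0,1). Then d_TV(θ*, N) ≤ ((3+√5)/2 + e) · E[|θ*|] / (2√(τ₁+s)), where e is Euler's number. -/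
open MeasureTheory Real Filter ProbabilityTheory
noncomputable section

/-- Gaussian tail. -/
def gT (x : ℝ) : ℝ := ∫ t in Set.Ioi x, exp (-(1/2) * t ^ 2)

/-- Mills ratio. -/
def gM (x : ℝ) : ℝ := exp (x ^ 2 / 2) * gT x

lemma gauss_int : Integrable (fun t : ℝ => exp (-(1/2) * t ^ 2)) :=
  integrable_exp_neg_mul_sq (by norm_num)

lemma gT_deriv (x : ℝ) : HasDerivAt gT (-exp (-(1/2) * x ^ 2)) x := by
  have h : gT = fun x => gT 0 - ∫ t in (0:ℝ)..x, exp (-(1/2) * t ^ 2) := by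
    funext y
    have := intervalIntegral.integral_interval_add_Ioi (a := 0) (b := y)
      (gauss_int.integrableOn) (gauss_int.integrableOn)
    simp only [gT]
    linarith
  rw [h]
  have hc : Continuous (fun t : ℝ => exp (-(1/2) * t ^ 2)) := by fun_prop
  exact (hc.integral_hasStrictDerivAt 0 x).hasDerivAt.const_sub (gT 0)

lemma gM_deriv (x : ℝ) : HasDerivAt gM (x * gM x - 1) x := by
  have h1 : HasDerivAt (fun x : ℝ => exp (x ^ 2 / 2)) (exp (x ^ 2 / 2) * x) x := by
    have h0 : HasDerivAt (fun x : ℝ => x ^ 2 / 2) x x := by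
      refine ((hasDerivAt_pow 2 x).div_const 2).congr_deriv ?_
      norm_num
    exact h0.exp
  have := h1.mul (gT_deriv x)
  refine this.congr_deriv ?_
  have h2 : exp (x ^ 2 / 2) * exp (-(1/2) * x ^ 2) = 1 := by
    rw [← exp_add]; simp; ring
  simp only [gM]
  linear_combination -h2

lemma gM_cont : Continuous gM :=
  continuous_iff_continuousAt.mpr fun x => (gM_deriv x).continuousAt

lemma gM_nonneg (x : ℝ) : 0 ≤ gM x :=
  mul_nonneg (exp_pos _).le (setIntegral_nonneg measurableSet_Ioi fun _ _ => (exp_pos _).le)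

lemma x_gM_le (x : ℝ) : x * gM x ≤ 1 := by
  have hI : Integrable (fun t : ℝ => t * exp (-(1/2) * t ^ 2)) :=
    integrable_mul_exp_neg_mul_sq (by norm_num)
  have hd : ∀ t ∈ Set.Ici x, HasDerivAt (fun t : ℝ => -exp (-(1/2) * t ^ 2))
      (t * exp (-(1/2) * t ^ 2)) t := by
    intro t _
    have h0 : HasDerivAt (fun t : ℝ => -(1/2) * t ^ 2) (-t) t := by
      refine ((hasDerivAt_pow 2 t).const_mul (-(1/2) : ℝ)).congr_deriv ?_
      norm_num
      ring
    refine h0.exp.neg.congr_deriv ?_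
    ring
  have ht : Tendsto (fun t : ℝ => -exp (-(1/2) * t ^ 2)) atTop (nhds 0) := by
    have h1 : Tendsto (fun t : ℝ => -(1/2) * t ^ 2) atTop atBot :=
      (tendsto_pow_atTop two_ne_zero).const_mul_atTop_of_neg (by norm_num)
    simpa using (tendsto_exp_atBot.comp h1).neg
  have h := integral_Ioi_of_hasDerivAt_of_tendsto' hd hI.integrableOn ht
  have h2 : x * gT x ≤ ∫ t in Set.Ioi x, t * exp (-(1/2) * t ^ 2) := by
    unfold gT
    rw [← integral_const_mul]
    refine setIntegral_mono_on (gauss_int.const_mul x).integrableOn hI.integrableOn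
      measurableSet_Ioi ?_
    intro t ht
    exact mul_le_mul_of_nonneg_right (le_of_lt ht) (exp_pos _).le
  rw [h] at h2
  have h3 : exp (x ^ 2 / 2) * exp (-(1/2) * x ^ 2) = 1 := by
    rw [← exp_add]; simp; ring
  have h4 := mul_le_mul_of_nonneg_left h2 (exp_pos (x ^ 2 / 2)).le
  simp only [gM]
  linarith

lemma gM_le (x : ℝ) (hx : 0 ≤ x) : gM x ≤ 4 / 3 := by
  have hanti : Antitone gM := antitone_of_hasDerivAt_nonpos gM_deriv
    (fun x => by
      show x * gM x - 1 ≤ 0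
      have := x_gM_le x; linarith)
  refine (hanti hx).trans ?_
  simp only [gM, gT]
  rw [integral_gaussian_Ioi]
  have : √(π / (1/2)) ≤ 8 / 3 := by
    rw [Real.sqrt_le_left (by norm_num)]
    have := Real.pi_lt_d2
    linarith
  simp
  simp at this
  linarith

/-- Half-line comparison. -/
lemma half_line (f H H' : ℝ → ℝ) (hf : IntegrableOn f (Set.Ioi 0)) (hfc : Continuous f)
    (hH : ∀ x, HasDerivAt H (H' x) x) (hHc : Continuous H')
    (hle : ∀ x, 0 ≤ x → -H' x ≤ f x) (hlim : Tendsto H atTop (nhds 0)) :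
    H 0 ≤ ∫ x in Set.Ioi 0, f x := by
  have h1 := intervalIntegral_tendsto_integral_Ioi (0:ℝ) hf tendsto_id
  have h2 := h1.add hlim
  rw [add_zero] at h2
  refine ge_of_tendsto h2 ?_
  filter_upwards [eventually_ge_atTop (0:ℝ)] with T hT
  have h3 := intervalIntegral.integral_eq_sub_of_hasDerivAt (a := 0) (b := T)
    (fun x _ => hH x) (hHc.intervalIntegrable _ _)
  have h4 : ∫ x in (0:ℝ)..T, -H' x ≤ ∫ x in (0:ℝ)..T, f x :=
    intervalIntegral.integral_mono_on hT (hHc.neg.intervalIntegrable _ _)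
      (hfc.intervalIntegrable _ _) (fun x hx => hle x hx.1)
  rw [intervalIntegral.integral_neg] at h4
  simp only [id]
  linarith

/-- Exponential decay gives integrability. -/
lemma decay_int (q : ℝ → ℝ) (hq : Continuous q) (h0 : ∀ x, 0 ≤ q x) (D c : ℝ) (hc : 0 < c)
    (hD : ∀ x, 0 ≤ x → q x ≤ D * exp (-c * x)) :
    IntegrableOn q (Set.Ioi 0) ∧ IntegrableOn (fun x => x * q x) (Set.Ioi 0) := by
  have hD0 : 0 ≤ D := by have := (h0 0).trans (hD 0 le_rfl); simpa using this
  constructor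
  · refine ((exp_neg_integrableOn_Ioi 0 hc).const_mul D).mono' hq.aestronglyMeasurable ?_
    filter_upwards [ae_restrict_mem measurableSet_Ioi] with x hx
    rw [Real.norm_of_nonneg (h0 x)]
    exact hD x (le_of_lt hx)
  · refine ((exp_neg_integrableOn_Ioi 0 (half_pos hc)).const_mul (D * (2 / c))).mono'
      (continuous_id.mul hq).aestronglyMeasurable ?_
    filter_upwards [ae_restrict_mem measurableSet_Ioi] with x hx
    have hx0 : 0 ≤ x := le_of_lt hx
    rw [Real.norm_of_nonneg (mul_nonneg hx0 (h0 x))]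
    have h1 : x ≤ (2 / c) * exp (c / 2 * x) := by
      have := Real.add_one_le_exp (c / 2 * x)
      have h2 : (2 / c) * (c / 2 * x) ≤ (2 / c) * exp (c / 2 * x) :=
        mul_le_mul_of_nonneg_left (by linarith) (by positivity)
      have h3 : (2 / c) * (c / 2 * x) = x := by field_simp
      linarith
    calc x * q x ≤ ((2 / c) * exp (c / 2 * x)) * (D * exp (-c * x)) :=
          mul_le_mul h1 (hD x hx0) (h0 x) (by positivity)
      _ = D * (2 / c) * (exp (c / 2 * x) * exp (-c * x)) := by ring
      _ = D * (2 / c) * exp (-(c / 2) * x) := by rw [← exp_add]; ring_nf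

lemma decay_lim (q G : ℝ → ℝ) (h0 : ∀ x, 0 ≤ q x) (D c A d : ℝ) (hc : 0 < c)
    (hD : ∀ x, 0 ≤ x → q x ≤ D * exp (-c * x)) (hG : ∀ x, 0 ≤ x → |G x| ≤ A + d * x ^ 2) :
    Tendsto (fun x => G x * q x) atTop (nhds 0) := by
  have hlim : Tendsto (fun x : ℝ => (A + d * x ^ 2) * (D * exp (-c * x))) atTop (nhds 0) := by
    have e0 : Tendsto (fun x : ℝ => exp (-c * x)) atTop (nhds 0) := by
      refine tendsto_exp_atBot.comp (tendsto_id.const_mul_atTop_of_neg (by linarith))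
    have e2 : Tendsto (fun x : ℝ => (c * x) ^ 2 * exp (-(c * x))) atTop (nhds 0) :=
      (tendsto_pow_mul_exp_neg_atTop_nhds_zero 2).comp (tendsto_id.const_mul_atTop hc)
    have := (e0.const_mul (A * D)).add (e2.const_mul (d * D / c ^ 2))
    simp only [mul_zero, add_zero] at this
    refine this.congr fun x => ?_
    rw [neg_mul]
    field_simp
  refine squeeze_zero_norm' ?_ hlim
  filter_upwards [eventually_ge_atTop (0:ℝ)] with x hx
  rw [norm_mul, Real.norm_of_nonneg (h0 x), Real.norm_eq_abs]
  exact mul_le_mul (hG x hx) (hD x hx) (h0 x) ((abs_nonneg _).trans (hG x hx))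

/-- The rescaled density. -/
def qd (C m x : ℝ) : ℝ := C * exp (m * x - m ^ 2 * exp (x / m))

lemma qd_nonneg {C : ℝ} (hC : 0 ≤ C) (m x : ℝ) : 0 ≤ qd C m x :=
  mul_nonneg hC (exp_pos _).le

lemma qd_cont (C m : ℝ) : Continuous (qd C m) := by unfold qd; fun_prop

lemma qd_deriv (C m : ℝ) (hm : 0 < m) (x : ℝ) :
    HasDerivAt (qd C m) (-(m * (exp (x / m) - 1)) * qd C m x) x := by
  have h1 : HasDerivAt (fun x : ℝ => exp (x / m)) (exp (x / m) * (1 / m)) x :=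
    ((hasDerivAt_id x).div_const m).exp
  have h2 : HasDerivAt (fun x : ℝ => m * x - m ^ 2 * exp (x / m))
      (m * 1 - m ^ 2 * (exp (x / m) * (1 / m))) x :=
    ((hasDerivAt_id x).const_mul m).sub (h1.const_mul _)
  refine (h2.exp.const_mul C).congr_deriv ?_
  unfold qd
  field_simp
  ring

lemma exp_neg_quad {u : ℝ} (hu : 0 ≤ u) : exp (-u) ≤ 1 - u + u ^ 2 / 2 := by
  have h1 := Real.quadratic_le_exp_of_nonneg hu
  have h2 : exp (-u) * exp u = 1 := by rw [← exp_add]; simp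
  have h3 := exp_pos (-u)
  have h4 : exp (-u) * (1 + u + u ^ 2 / 2) ≤ 1 := by
    exact (mul_le_mul_of_nonneg_left h1 h3.le).trans h2.le
  have h5 : 0 < 1 + u + u ^ 2 / 2 := by positivity
  rw [← mul_le_mul_iff_left₀ h5]
  nlinarith [sq_nonneg (u ^ 2)]

/-- Comparison with the Gaussian shape, right side. -/
lemma qd_le_pos {C : ℝ} (hC : 0 ≤ C) {m : ℝ} (hm : 0 < m) {x : ℝ} (hx : 0 ≤ x) :
    qd C m x ≤ C * exp (-m ^ 2) * exp (-(x ^ 2) / 2) := by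
  unfold qd
  rw [mul_assoc, ← exp_add]
  refine mul_le_mul_of_nonneg_left (exp_le_exp.mpr ?_) hC
  have h1 := Real.quadratic_le_exp_of_nonneg (div_nonneg hx hm.le)
  have h2 := mul_le_mul_of_nonneg_left h1 (sq_nonneg m)
  have h3 : m ^ 2 * (1 + x / m + (x / m) ^ 2 / 2) = m ^ 2 + m * x + x ^ 2 / 2 := by
    field_simp
  linarith

/-- Comparison with the Gaussian shape, left side. -/
lemma le_qd_neg {C : ℝ} (hC : 0 ≤ C) {m : ℝ} (hm : 0 < m) {x : ℝ} (hx : 0 ≤ x) :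
    C * exp (-m ^ 2) * exp (-(x ^ 2) / 2) ≤ qd C m (-x) := by
  unfold qd
  rw [mul_assoc, ← exp_add]
  refine mul_le_mul_of_nonneg_left (exp_le_exp.mpr ?_) hC
  have h1 := exp_neg_quad (div_nonneg hx hm.le)
  have h2 := mul_le_mul_of_nonneg_left h1 (sq_nonneg m)
  have h3 : m ^ 2 * (1 - x / m + (x / m) ^ 2 / 2) = m ^ 2 - m * x + x ^ 2 / 2 := by
    field_simp
  rw [neg_div, neg_div]
  linarith

lemma qd_decay_pos {C : ℝ} (hC : 0 ≤ C) {m : ℝ} (hm : 0 < m) (x : ℝ) (hx : 0 ≤ x) :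
    qd C m x ≤ (C * exp (-m ^ 2) * exp 1) * exp (-1 * x) := by
  refine (qd_le_pos hC hm hx).trans ?_
  rw [mul_assoc _ (exp 1), ← exp_add]
  refine mul_le_mul_of_nonneg_left (exp_le_exp.mpr ?_) (by positivity)
  nlinarith [sq_nonneg (x - 1)]

lemma qd_decay_neg {C : ℝ} (hC : 0 ≤ C) {m : ℝ} (x : ℝ) :
    qd C m (-x) ≤ C * exp (-m * x) := by
  unfold qd
  refine mul_le_mul_of_nonneg_left (exp_le_exp.mpr ?_) hC
  have : 0 ≤ m ^ 2 * exp (-x / m) := by positivity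
  linarith

lemma ineq_pos_large {m u M : ℝ} (hm : 3 / 2 ≤ m) (hu : 0 ≤ u) (hM : 0 ≤ M)
    (h1 : m * u * M ≤ 1) :
    m * (exp u - 1) * (M - u ^ 2 / m) - (m * u * M - 1 - 2 * u / m ^ 2) ≤ 1 + 2 * u := by
  have hm0 : 0 < m := by linarith
  have e1 : m * (exp u - 1) * (M - u ^ 2 / m) = m * M * (exp u - 1) - (exp u - 1) * u ^ 2 := by
    field_simp
  have e2 : 2 * u / m ^ 2 ≤ u := by
    rw [div_le_iff₀ (by positivity)]
    have : 2 ≤ m ^ 2 := by nlinarith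
    nlinarith
  have e3 := Real.add_one_le_exp u
  have hmM : 0 ≤ m * M := by positivity
  rw [e1]
  suffices h : m * M * (exp u - 1 - u) ≤ u + (exp u - 1) * u ^ 2 by linarith
  rcases le_total u 1 with hu1 | hu1
  · have h2 := (abs_le.mp (Real.abs_exp_sub_one_sub_id_le (x := u)
      (by rw [abs_of_nonneg hu]; exact hu1))).2
    have h3 := mul_le_mul_of_nonneg_left h2 hmM
    have h4 : 0 ≤ (exp u - 1) * u ^ 2 := mul_nonneg (by linarith) (sq_nonneg u)
    nlinarith [mul_le_mul_of_nonneg_left h1 hu]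
  · have h2 : m * M ≤ 1 := by nlinarith
    have h3 : m * M * (exp u - 1 - u) ≤ 1 * (exp u - 1 - u) :=
      mul_le_mul_of_nonneg_right h2 (by linarith)
    have h4 : (exp u - 1) * 1 ≤ (exp u - 1) * u ^ 2 :=
      mul_le_mul_of_nonneg_left (by nlinarith) (by linarith)
    linarith

lemma ineq_pos_small {m u M : ℝ} (hm0 : 0 < m) (hm : m ≤ 3 / 2) (hu : 0 ≤ u)
    (hM : M ≤ 4 / 3) :
    m * (exp u - 1) * (M - 4 / 3) - (m * u * M - 1) ≤ 1 + 2 * u := by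
  have e3 := Real.add_one_le_exp u
  have h : 0 ≤ m * (exp u - 1 - u) * (4 / 3 - M) :=
    mul_nonneg (mul_nonneg hm0.le (by linarith)) (by linarith)
  have h2 : 0 ≤ m * u := by positivity
  linarith

lemma ineq_neg_large {m u M : ℝ} (hm0 : 0 < m) (hu : 0 ≤ u) (hM : 0 ≤ M)
    (h1 : m * u * M ≤ 1) :
    m * u * M - 1 - m * (1 - exp (-u)) * M ≤ 2 * u - 1 := by
  have e := exp_neg_quad hu
  have hmM : 0 ≤ m * M := by positivity
  have h3 := mul_le_mul_of_nonneg_left e hmM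
  nlinarith [mul_le_mul_of_nonneg_left h1 hu]

lemma ineq_neg_small {m u M : ℝ} (hm0 : 0 < m) (hm : m ≤ 3 / 2) (hu : 0 ≤ u)
    (hM : M ≤ 4 / 3) :
    m * u * M - 1 - m * (1 - exp (-u)) * (M - 4 / 3) ≤ 2 * u - 1 := by
  have e3 := Real.add_one_le_exp (-u)
  have h : 0 ≤ m * (exp (-u) - 1 + u) * (4 / 3 - M) :=
    mul_nonneg (mul_nonneg hm0.le (by linarith)) (by linarith)
  have h2 : 0 ≤ (3 / 2 - m) * u := mul_nonneg (by linarith) hu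
  linarith

lemma core_pos {C : ℝ} (hC : 0 ≤ C) {m : ℝ} (hm : 0 < m) (G G' : ℝ → ℝ) (A d : ℝ)
    (hG : ∀ x, HasDerivAt G (G' x) x) (hGc : Continuous G') 
    (hb : ∀ x, 0 ≤ x → |G x| ≤ A + d * x ^ 2)
    (h : ∀ x, 0 ≤ x → m * (exp (x / m) - 1) * G x - G' x ≤ 1 + 2 * (x / m)) :
    G 0 * qd C m 0 ≤ (∫ x in Set.Ioi 0, qd C m x) + 2 / m * ∫ x in Set.Ioi 0, x * qd C m x := by
  obtain ⟨i1, i2⟩ := decay_int (qd C m) (qd_cont C m) (qd_nonneg hC m) _ 1 one_pos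
    (qd_decay_pos hC hm)
  have hGc0 : Continuous G := continuous_iff_continuousAt.mpr fun x => (hG x).continuousAt
  have hq := qd_cont C m
  rw [← integral_const_mul, ← integral_add i1 (i2.const_mul _)]
  refine half_line _ (fun x => G x * qd C m x)
    (fun x => G' x * qd C m x + G x * (-(m * (exp (x / m) - 1)) * qd C m x))
    (i1.add (i2.const_mul _)) (by fun_prop) (fun x => (hG x).mul (qd_deriv C m hm x))
    (by fun_prop) ?_ (decay_lim _ G (qd_nonneg hC m) _ 1 A d one_pos (qd_decay_pos hC hm) hb)
  intro x hx
  have := mul_le_mul_of_nonneg_right (h x hx) (qd_nonneg hC m x)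
  have e : 2 / m * (x * qd C m x) = 2 * (x / m) * qd C m x := by ring
  rw [e]
  linarith

lemma core_neg {C : ℝ} (hC : 0 ≤ C) {m : ℝ} (hm : 0 < m) (G G' : ℝ → ℝ) (A d : ℝ)
    (hG : ∀ x, HasDerivAt G (G' x) x) (hGc : Continuous G') 
    (hb : ∀ x, 0 ≤ x → |G x| ≤ A + d * x ^ 2)
    (h : ∀ x, 0 ≤ x → G' x - m * (1 - exp (-(x / m))) * G x ≤ 2 * (x / m) - 1) :
    (∫ x in Set.Ioi 0, qd C m (-x)) - 2 / m * ∫ x in Set.Ioi 0, x * qd C m (-x)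
      ≤ G 0 * qd C m 0 := by
  have hq : Continuous (fun x => qd C m (-x)) := (qd_cont C m).comp continuous_neg
  obtain ⟨i1, i2⟩ := decay_int (fun x => qd C m (-x)) hq (fun x => qd_nonneg hC m _) C m hm
    (fun x _ => qd_decay_neg hC x)
  have hGc0 : Continuous G := continuous_iff_continuousAt.mpr fun x => (hG x).continuousAt
  rw [← integral_const_mul, ← integral_sub i1 (i2.const_mul _)]
  have hd : ∀ x, HasDerivAt (fun x => qd C m (-x))
      (-(m * (1 - exp (-(x / m)))) * qd C m (-x)) x := by
    intro x
    have := (qd_deriv C m hm (-x)).scomp x (hasDerivAt_neg x)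
    refine this.congr_deriv ?_
    rw [neg_div, smul_eq_mul]
    ring
  have key := half_line (fun x => -(qd C m (-x) - 2 / m * (x * qd C m (-x))))
    (fun x => -(G x * qd C m (-x)))
    (fun x => -(G' x * qd C m (-x) + G x * (-(m * (1 - exp (-(x / m)))) * qd C m (-x))))
    (i1.sub (i2.const_mul _)).neg (by fun_prop) (fun x => ((hG x).mul (hd x)).neg)
    (by fun_prop) ?_ (by
      have := (decay_lim _ G (fun x => qd_nonneg hC m (-x)) _ m A d hm
        (fun x _ => qd_decay_neg hC x) hb).neg
      simpa using this)
  · rw [integral_neg, neg_zero] at key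
    linarith
  · intro x hx
    have := mul_le_mul_of_nonneg_right (h x hx) (qd_nonneg hC m (-x))
    have e : 2 / m * (x * qd C m (-x)) = 2 * (x / m) * qd C m (-x) := by ring
    rw [e]
    linarith

lemma core {C : ℝ} (hC : 0 ≤ C) {m : ℝ} (hm : 0 < m) :
    (∫ x in Set.Ioi 0, qd C m (-x)) - (∫ x in Set.Ioi 0, qd C m x) ≤
      2 / m * ((∫ x in Set.Ioi 0, x * qd C m x) + ∫ x in Set.Ioi 0, x * qd C m (-x)) := by
  have hMc := gM_cont
  have hx : ∀ x, m * (x / m) = x := fun x => by field_simp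
  rcases le_total m (3 / 2) with h | h
  · have hd : ∀ x, HasDerivAt (fun x => gM x - 4 / 3) (x * gM x - 1) x :=
      fun x => (gM_deriv x).sub_const _
    have hb : ∀ x, 0 ≤ x → |gM x - 4 / 3| ≤ 4 / 3 + 0 * x ^ 2 := by
      intro x hx
      have := gM_nonneg x
      have := gM_le x hx
      rw [abs_le]; constructor <;> linarith
    have h1 := core_pos hC hm _ _ _ _ hd (by fun_prop) hb (fun x hx0 => by
      have := ineq_pos_small hm h (div_nonneg hx0 hm.le) (gM_le x hx0)
      rwa [hx] at this)
    have h2 := core_neg hC hm _ _ _ _ hd (by fun_prop) hb (fun x hx0 => by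
      have := ineq_neg_small hm h (div_nonneg hx0 hm.le) (gM_le x hx0)
      rwa [hx] at this)
    linarith
  · have hd : ∀ x, HasDerivAt (fun x => gM x - x ^ 2 / m ^ 3)
        (x * gM x - 1 - 2 * x / m ^ 3) x := by
      intro x
      refine ((gM_deriv x).sub ((hasDerivAt_pow 2 x).div_const (m ^ 3))).congr_deriv ?_
      norm_num
    have hb : ∀ x, 0 ≤ x → |gM x - x ^ 2 / m ^ 3| ≤ 4 / 3 + (1 / m ^ 3) * x ^ 2 := by
      intro x hx
      have := gM_nonneg x
      have := gM_le x hx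
      have e : (1 / m ^ 3) * x ^ 2 = x ^ 2 / m ^ 3 := by ring
      have : 0 ≤ x ^ 2 / m ^ 3 := by positivity
      rw [abs_le, e]; constructor <;> linarith
    have hb' : ∀ x, 0 ≤ x → |gM x| ≤ 4 / 3 + 0 * x ^ 2 := by
      intro x hx
      have := gM_nonneg x
      have := gM_le x hx
      rw [abs_le]; constructor <;> linarith
    have hxM : ∀ x, m * (x / m) * gM x ≤ 1 := fun x => by rw [hx]; exact x_gM_le x
    have h1 := core_pos hC hm _ _ _ _ hd (by fun_prop) hb (fun x hx0 => by
      have := ineq_pos_large h (div_nonneg hx0 hm.le) (gM_nonneg x) (hxM x)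
      rw [hx] at this
      have e1 : (x / m) ^ 2 / m = x ^ 2 / m ^ 3 := by field_simp
      have e2 : 2 * (x / m) / m ^ 2 = 2 * x / m ^ 3 := by field_simp
      rwa [e1, e2] at this)
    have h2 := core_neg hC hm _ _ _ _ gM_deriv (by fun_prop) hb' (fun x hx0 => by
      have := ineq_neg_large hm (div_nonneg hx0 hm.le) (gM_nonneg x) (hxM x)
      rwa [hx] at this)
    simp only [ne_eq, OfNat.ofNat_ne_zero, not_false_eq_true, zero_pow, zero_div, sub_zero] at h1
    linarith

lemma tv_core {C : ℝ} (hC : 0 ≤ C) {m : ℝ} (hm : 0 < m) (hq1 : ∫ x, qd C m x = 1)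
    (A : Set ℝ) (hA : MeasurableSet A) :
    |(∫ x in A, qd C m x) - ∫ x in A, gaussianPDFReal 0 1 x| ≤
      (∫ x in Set.Ioi 0, qd C m (-x)) - ∫ x in Set.Ioi 0, qd C m x := by
  have hqi : Integrable (qd C m) := by
    by_contra h
    rw [integral_undef h] at hq1
    norm_num at hq1
  set g : ℝ → ℝ := fun x => C * exp (-m ^ 2) * exp (-(x ^ 2) / 2) with hg
  obtain ⟨R, hR⟩ : ∃ R : ℝ, ∀ x, g x = R * gaussianPDFReal 0 1 x := by
    refine ⟨C * exp (-m ^ 2) * √(2 * π), fun x => ?_⟩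
    simp only [hg, gaussianPDFReal]
    have : √(2 * π) ≠ 0 := by positivity
    simp only [NNReal.coe_one, mul_one, sub_zero]
    field_simp
  have hgR : g = fun x => R * gaussianPDFReal 0 1 x := funext hR
  have hφ := integrable_gaussianPDFReal 0 1
  have hgi : Integrable g := by rw [hgR]; exact hφ.const_mul R
  set p : ℝ := ∫ x in A, gaussianPDFReal 0 1 x with hp
  have hφ1 : ∫ x, gaussianPDFReal 0 1 x = 1 := integral_gaussianPDFReal_eq_one 0 one_ne_zero
  have hp0 : 0 ≤ p := setIntegral_nonneg hA fun x _ => gaussianPDFReal_nonneg 0 1 x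
  have hp1 : p ≤ 1 := by
    rw [← hφ1]
    exact setIntegral_le_integral hφ (ae_of_all _ fun x => gaussianPDFReal_nonneg 0 1 x)
  have hgA : ∫ x in A, g x = R * p := by rw [hgR, integral_const_mul]
  have hgT : ∫ x, g x = R := by rw [hgR, integral_const_mul, hφ1, mul_one]
  have hdi : Integrable (fun x => qd C m x - g x) := hqi.sub hgi
  have hF : (∫ x in A, qd C m x) - p =
      ∫ x, (A.indicator (fun x => qd C m x - g x) x - p * (qd C m x - g x)) := by
    rw [integral_sub (hdi.indicator hA) (hdi.const_mul p), integral_indicator hA,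
      integral_const_mul, integral_sub hqi hgi, integral_sub hqi.integrableOn hgi.integrableOn,
      hgA, hgT, hq1]
    ring
  have hneg : ∀ x, g (-x) = g x := fun x => by simp [hg]
  have habs : ∫ x, |qd C m x - g x| =
      (∫ x in Set.Ioi 0, qd C m (-x)) - ∫ x in Set.Ioi 0, qd C m x := by
    have hai := hdi.abs
    rw [← intervalIntegral.integral_Iic_add_Ioi (b := 0) hai.integrableOn hai.integrableOn]
    have h1 : ∫ x in Set.Iic 0, |qd C m x - g x| =
        (∫ x in Set.Ioi 0, qd C m (-x)) - ∫ x in Set.Ioi 0, g x := by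
      have := integral_comp_neg_Ioi 0 (fun x => |qd C m x - g x|)
      rw [neg_zero] at this
      rw [← this, ← integral_sub hqi.comp_neg.integrableOn hgi.integrableOn]
      refine setIntegral_congr_fun measurableSet_Ioi fun x hx => ?_
      have := le_qd_neg hC hm (le_of_lt hx)
      simp only [hneg]
      exact abs_of_nonneg (sub_nonneg.mpr this)
    have h2 : ∫ x in Set.Ioi 0, |qd C m x - g x| =
        (∫ x in Set.Ioi 0, g x) - ∫ x in Set.Ioi 0, qd C m x := by
      rw [← integral_sub hgi.integrableOn hqi.integrableOn]
      refine setIntegral_congr_fun measurableSet_Ioi fun x hx => ?_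
      have := qd_le_pos hC hm (le_of_lt hx)
      try simp only
      rw [abs_sub_comm]
      exact abs_of_nonneg (sub_nonneg.mpr this)
    rw [h1, h2]
    ring
  rw [hF, ← habs]
  refine (abs_integral_le_integral_abs).trans ?_
  refine integral_mono ((hdi.indicator hA).sub (hdi.const_mul p)).abs hdi.abs fun x => ?_
  by_cases hx : x ∈ A
  · simp only [Set.indicator_of_mem hx]
    have : qd C m x - g x - p * (qd C m x - g x) = (1 - p) * (qd C m x - g x) := by ring
    rw [this, abs_mul, abs_of_nonneg (by linarith : 0 ≤ 1 - p)]
    exact mul_le_of_le_one_left (abs_nonneg _) (by linarith)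
  · simp only [Set.indicator_of_notMem hx]
    rw [zero_sub, abs_neg, abs_mul, abs_of_nonneg hp0]
    exact mul_le_of_le_one_left (abs_nonneg _) hp1

lemma abs_moment {C : ℝ} (hC : 0 ≤ C) {m : ℝ} (hm : 0 < m) :
    ∫ x, qd C m x * |x| =
      (∫ x in Set.Ioi 0, x * qd C m x) + ∫ x in Set.Ioi 0, x * qd C m (-x) := by
  have i2 := (decay_int (qd C m) (qd_cont C m) (qd_nonneg hC m) _ 1 one_pos
    (qd_decay_pos hC hm)).2
  have hq : Continuous (fun x => qd C m (-x)) := (qd_cont C m).comp continuous_neg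
  have j2 := (decay_int (fun x => qd C m (-x)) hq (fun x => qd_nonneg hC m _) C m hm
    (fun x _ => qd_decay_neg hC x)).2
  have a1 : IntegrableOn (fun x => qd C m x * |x|) (Set.Ioi 0) := by
    refine i2.congr_fun (fun x hx => ?_) measurableSet_Ioi
    try simp only
    rw [abs_of_pos hx, mul_comm]
  have a2 : IntegrableOn (fun x => qd C m x * |x|) (Set.Iic 0) := by
    have h : IntegrableOn (fun x => qd C m (-x) * |(-x)|) (Set.Ioi 0) := by
      refine j2.congr_fun (fun x hx => ?_) measurableSet_Ioi
      try simp only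
      rw [abs_neg, abs_of_pos hx, mul_comm]
    have := (Iff.mpr integrableOn_Ici_iff_integrableOn_Ioi h).comp_neg
    simpa using this
  rw [← intervalIntegral.integral_Iic_add_Ioi (b := 0) a2 a1, add_comm]
  congr 1
  · refine setIntegral_congr_fun measurableSet_Ioi fun x hx => ?_
    try simp only
    rw [abs_of_pos hx, mul_comm]
  · have := integral_comp_neg_Ioi 0 (fun x => qd C m x * |x|)
    rw [neg_zero] at this
    rw [← this]
    refine setIntegral_congr_fun measurableSet_Ioi fun x hx => ?_
    try simp only
    rw [abs_neg, abs_of_pos hx, mul_comm]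

/-- Total variation bound for the Poisson posterior with gamma
prior: with `λ(w) = −τ₁w + (n+τ₂)e^w`, posterior density
`p(w) = κ exp(ws − λ(w))`, posterior mode `θ̃ = log((τ₁+s)/(n+τ₂))` and
`θ* = √(τ₁+s)(θ − θ̃)`,
`d_TV(θ*, N) ≤ ((3+√5)/2 + e) · E[|θ*|] / (2√(τ₁+s))`. -/
theorem tv_bound_poisson_gamma
    (n : ℕ) (hn : 1 ≤ n)
    (τ₁ τ₂ : ℝ) (hτ₁ : 0 < τ₁) (hτ₂ : 0 < τ₂) (s : ℝ) (hs : 0 ≤ s)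
    {Ω : Type*} [MeasurableSpace Ω] (P : Measure Ω) [IsProbabilityMeasure P]
    (κ : ℝ) (hκ : 0 < κ)
    (θ : Ω → ℝ) (hθmeas : Measurable θ)
    -- θ has density p(w) = κ exp(ws − λ(w)) with λ(w) = −τ₁w + (n+τ₂)e^w
    (hdens : Measure.map θ P =
      volume.withDensity fun w =>
        ENNReal.ofReal (κ * Real.exp (w * s - (-τ₁ * w + (n + τ₂) * Real.exp w))))
    -- the standardised posterior θ* = √(τ₁+s)(θ − θ̃), θ̃ = log((τ₁+s)/(n+τ₂))
    (θstar : Ω → ℝ)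
    (hθstar : ∀ ω, θstar ω =
      Real.sqrt (τ₁ + s) * (θ ω - Real.log ((τ₁ + s) / (n + τ₂)))) :
    ∀ A : Set ℝ, MeasurableSet A →
      |(P (θstar ⁻¹' A)).toReal - (gaussianReal 0 1 A).toReal| ≤
        ((3 + Real.sqrt 5) / 2 + Real.exp 1) *
          (∫ ω, |θstar ω| ∂P) / (2 * Real.sqrt (τ₁ + s)) := by
  intro A hA
  have hn0 : (0:ℝ) ≤ n := Nat.cast_nonneg n
  have ha : 0 < τ₁ + s := by linarith
  have hb : 0 < (n:ℝ) + τ₂ := by linarith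
  set m : ℝ := √(τ₁ + s) with hmdef
  have hm : 0 < m := Real.sqrt_pos.mpr ha
  have hm2 : m ^ 2 = τ₁ + s := Real.sq_sqrt ha.le
  set c : ℝ := Real.log ((τ₁ + s) / (n + τ₂)) with hc
  have hec : ((n:ℝ) + τ₂) * exp c = τ₁ + s := by
    rw [hc, Real.exp_log (by positivity)]
    field_simp
  set C : ℝ := κ * exp ((τ₁ + s) * c) / m with hCdef
  have hC : 0 ≤ C := by positivity
  have hpw : ∀ w, κ * Real.exp (w * s - (-τ₁ * w + (n + τ₂) * Real.exp w)) =
      m * qd C m (m * (w - c)) := by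
    intro w
    have e1 : m * (w - c) / m = w - c := by field_simp
    have e2 : m * (m * (w - c)) = (τ₁ + s) * (w - c) := by rw [← hm2]; ring
    have e3 : (τ₁ + s) * exp (w - c) = (n + τ₂) * exp w := by
      rw [← hec, mul_assoc, ← exp_add]
      ring_nf
    have e4 : m * C = κ * exp ((τ₁ + s) * c) := by rw [hCdef]; field_simp
    unfold qd
    rw [e1, e2, hm2, e3, ← mul_assoc, e4, mul_assoc, ← exp_add]
    ring_nf
  have hst : θstar = fun ω => m * (θ ω - c) := funext hθstar
  have hE : ∀ ψ : ℝ → ℝ, Measurable ψ → ∫ ω, ψ (θstar ω) ∂P = ∫ x, qd C m x * ψ x := by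
    intro ψ hψ
    have hψ' : Measurable (fun w => ψ (m * (w - c))) := hψ.comp (by fun_prop)
    have h1 : ∫ ω, ψ (θstar ω) ∂P = ∫ w, ψ (m * (w - c)) ∂(Measure.map θ P) := by
      rw [integral_map hθmeas.aemeasurable hψ'.aestronglyMeasurable, hst]
    rw [h1, hdens, integral_withDensity_eq_integral_toReal_smul (by fun_prop)
      (ae_of_all _ fun _ => ENNReal.ofReal_lt_top)]
    have h2 : ∀ w : ℝ, (ENNReal.ofReal (κ * Real.exp (w * s - (-τ₁ * w + (n + τ₂) *
        Real.exp w)))).toReal • ψ (m * (w - c)) =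
        (fun y => m * qd C m (m * y) * ψ (m * y)) (w - c) := by
      intro w
      rw [ENNReal.toReal_ofReal (by positivity), hpw, smul_eq_mul]
    simp_rw [h2]
    rw [integral_sub_right_eq_self (fun y => m * qd C m (m * y) * ψ (m * y)) c,
      Measure.integral_comp_mul_left (fun y => m * qd C m y * ψ y) m,
      abs_of_pos (inv_pos.mpr hm), smul_eq_mul, ← integral_const_mul]
    refine integral_congr_ae (ae_of_all _ fun x => ?_)
    try simp only
    field_simp
  have hst_meas : Measurable θstar := by rw [hst]; fun_prop
  have hq1 : ∫ x, qd C m x = 1 := by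
    have := hE (fun _ => 1) measurable_const
    simpa using this.symm
  have hPA : (P (θstar ⁻¹' A)).toReal = ∫ x in A, qd C m x := by
    have h := hE (A.indicator fun _ => 1) (measurable_const.indicator hA)
    have h3 : ∀ x, qd C m x * A.indicator (fun _ => (1:ℝ)) x = A.indicator (qd C m) x := by
      intro x
      by_cases hx : x ∈ A <;> simp [hx]
    simp_rw [h3] at h
    rw [integral_indicator hA] at h
    rw [← h]
    have h4 : ∀ ω, A.indicator (fun _ => (1:ℝ)) (θstar ω) =
        (θstar ⁻¹' A).indicator (fun _ => (1:ℝ)) ω := fun ω => rfl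
    simp_rw [h4]
    rw [integral_indicator_const _ (hst_meas hA)]
    simp [Measure.real]
  have hgA : (gaussianReal 0 1 A).toReal = ∫ x in A, gaussianPDFReal 0 1 x := by
    rw [gaussianReal_apply_eq_integral 0 one_ne_zero, ENNReal.toReal_ofReal]
    exact setIntegral_nonneg hA fun x _ => gaussianPDFReal_nonneg 0 1 x
  have hEabs := hE (fun x => |x|) (by fun_prop)
  rw [abs_moment hC hm] at hEabs
  have hfin := (tv_core hC hm hq1 A hA).trans (core hC hm)
  rw [← hEabs] at hfin
  rw [hPA, hgA]
  refine hfin.trans ?_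
  have hI : 0 ≤ ∫ ω, |θstar ω| ∂P := integral_nonneg fun _ => abs_nonneg _
  have h5 : (2:ℝ) ≤ √5 := by
    rw [Real.le_sqrt (by norm_num) (by norm_num)]; norm_num
  have h6 := Real.exp_one_gt_d9
  have h7 : 4 * (∫ ω, |θstar ω| ∂P) / (2 * m) ≤
      ((3 + √5) / 2 + exp 1) * (∫ ω, |θstar ω| ∂P) / (2 * m) := by
    gcongr
    linarith
  refine le_trans (le_of_eq ?_) h7
  field_simp
  ring
end
end

section
/- Total variation bound for the mode-standardised gamma distribution: let α > 1 and β > 0, let X be a random variable with the Gamma(α, β) distribution (density β^α w^{α−1} e^{−βw}/Γ(α) for w > 0), and set X* = (β/√(α−1))·(X − (α−1)/β), i.e., X standardised around its mode (α−1)/β. Let N ~ N(0,1). Then d_TV(X*, N) ≤ √(π / (8(α−1))). -/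
open MeasureTheory Real ProbabilityTheory

noncomputable section

/-- standard normal cdf -/
def Phi (x : ℝ) : ℝ := (gaussianReal 0 1).real (Set.Iic x)

lemma Phi_eq (x : ℝ) : Phi x = Phi 0 + ∫ t in (0:ℝ)..x, gaussianPDFReal 0 1 t := by
  have key : ∀ y, Phi y = ∫ t in Set.Iic y, gaussianPDFReal 0 1 t := by
    intro y
    unfold Phi
    rw [measureReal_def, gaussianReal_apply_eq_integral 0 one_ne_zero, ENNReal.toReal_ofReal]
    exact integral_nonneg fun t => gaussianPDFReal_nonneg _ _ _
  rw [key, key, ← intervalIntegral.integral_Iic_sub_Iic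
    (integrable_gaussianPDFReal 0 1).integrableOn (integrable_gaussianPDFReal 0 1).integrableOn]
  ring

lemma gpdf_eq (x : ℝ) : gaussianPDFReal 0 1 x = (√(2 * π))⁻¹ * exp (-x ^ 2 / 2) := by
  simp [gaussianPDFReal]

lemma Phi_hasDeriv (x : ℝ) : HasDerivAt Phi ((√(2 * π))⁻¹ * exp (-x ^ 2 / 2)) x := by
  have hc : Continuous (gaussianPDFReal 0 1) := by
    have : gaussianPDFReal 0 1 = fun x => (√(2 * π))⁻¹ * exp (-x ^ 2 / 2) := funext gpdf_eq
    rw [this]; fun_prop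
  have h := (intervalIntegral.integral_hasDerivAt_right (hc.intervalIntegrable 0 x)
    hc.stronglyMeasurable.stronglyMeasurableAtFilter hc.continuousAt).const_add (Phi 0)
  rw [gpdf_eq] at h
  exact h.congr_of_eventuallyEq (Filter.Eventually.of_forall fun y => Phi_eq y)

lemma Phi_compl (x : ℝ) : (gaussianReal 0 1).real (Set.Ioi x) = 1 - Phi x := by
  unfold Phi
  rw [← Set.compl_Iic, probReal_compl_eq_one_sub measurableSet_Iic]

lemma Phi_neg (x : ℝ) : Phi (-x) = 1 - Phi x := by
  have : NullSingletonClass (gaussianReal 0 1) := nullSingletonClass_gaussianReal one_ne_zero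
  rw [← Phi_compl]
  unfold Phi
  rw [measureReal_def, measureReal_def, measure_congr (Ioi_ae_eq_Ici (μ := gaussianReal 0 1) (a := x))]
  have h := gaussianReal_map_neg (μ := 0) (v := 1)
  rw [neg_zero] at h
  conv_lhs => rw [← h, Measure.map_apply (by fun_prop) measurableSet_Iic]
  congr 2
  ext y; simp

lemma Phi_zero : Phi 0 = 1 / 2 := by
  have := Phi_neg 0
  rw [neg_zero] at this
  linarith

lemma Phi_tendsto : Filter.Tendsto Phi Filter.atTop (nhds 1) := by
  have := tendsto_cdf_atTop (gaussianReal 0 1)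
  refine this.congr fun x => ?_
  rw [cdf_eq_real]; rfl

def bfun (x : ℝ) : ℝ := -x + 4 * (√(2 * π))⁻¹ * (2 * Phi x - 1)

def Dfun (x : ℝ) : ℝ := exp (-x ^ 2 / 2) - 4 * (Phi x * (1 - Phi x))

lemma bfun_deriv (x : ℝ) :
    HasDerivAt bfun (-1 + 8 * (√(2 * π))⁻¹ ^ 2 * exp (-x ^ 2 / 2)) x := by
  have := (hasDerivAt_id x).neg.add
    ((((Phi_hasDeriv x).const_mul 2).sub_const 1).const_mul (4 * (√(2 * π))⁻¹))
  convert! this using 1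
  ring

lemma Dfun_deriv (x : ℝ) : HasDerivAt Dfun (exp (-x ^ 2 / 2) * bfun x) x := by
  have h1 : HasDerivAt (fun x : ℝ => exp (-x ^ 2 / 2)) (exp (-x ^ 2 / 2) * (-x)) x := by
    have : HasDerivAt (fun x : ℝ => -x ^ 2 / 2) (-x) x := by
      have := ((hasDerivAt_pow 2 x).neg.div_const 2)
      convert! this using 1
      simp; ring
    exact this.exp
  have h2 := h1.sub (((Phi_hasDeriv x).mul ((Phi_hasDeriv x).const_sub 1)).const_mul 4)
  convert! h2 using 1
  unfold bfun; ring

lemma Dfun_nonneg_of_nonneg (x : ℝ) (hx : 0 ≤ x) : 0 ≤ Dfun x := by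
  by_contra! hneg
  have hD0 : Dfun 0 = 0 := by simp [Dfun, Phi_zero]; norm_num
  have hb0 : bfun 0 = 0 := by simp [bfun, Phi_zero]
  have hx0 : 0 < x := by
    rcases hx.eq_or_lt with h | h
    · rw [← h, hD0] at hneg; exact absurd hneg (lt_irrefl _)
    · exact h
  obtain ⟨ξ, hξ, hξ'⟩ := exists_hasDerivAt_eq_slope Dfun _ hx0
    (fun y _ => (Dfun_deriv y).continuousAt.continuousWithinAt) (fun y _ => Dfun_deriv y)
  have hbξ : bfun ξ < 0 := by
    have : exp (-ξ ^ 2 / 2) * bfun ξ < 0 := by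
      rw [hξ', hD0]; exact div_neg_of_neg_of_pos (by linarith) (by linarith)
    exact (pos_iff_neg_of_mul_neg this).1 (exp_pos _)
  obtain ⟨η, hη, hη'⟩ := exists_hasDerivAt_eq_slope bfun _ hξ.1
    (fun y _ => (bfun_deriv y).continuousAt.continuousWithinAt) (fun y _ => bfun_deriv y)
  have hbη : -1 + 8 * (√(2 * π))⁻¹ ^ 2 * exp (-η ^ 2 / 2) < 0 := by
    rw [hη', hb0]; exact div_neg_of_neg_of_pos (by linarith) (by linarith [hξ.1])
  have hanti : AntitoneOn bfun (Set.Ici ξ) := by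
    refine antitoneOn_of_deriv_nonpos (convex_Ici ξ)
      (fun y _ => (bfun_deriv y).continuousAt.continuousWithinAt)
      (fun y _ => (bfun_deriv y).differentiableAt.differentiableWithinAt) ?_
    intro y hy
    rw [interior_Ici] at hy
    rw [(bfun_deriv y).deriv]
    have : exp (-y ^ 2 / 2) ≤ exp (-η ^ 2 / 2) := by
      apply exp_le_exp.2
      have h1 : η ≤ y := hη.2.le.trans (le_of_lt hy)
      nlinarith [hη.1]
    have := mul_le_mul_of_nonneg_left this (show 0 ≤ 8 * (√(2 * π))⁻¹ ^ 2 by positivity)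
    linarith
  have hDanti : AntitoneOn Dfun (Set.Ici ξ) := by
    refine antitoneOn_of_deriv_nonpos (convex_Ici ξ)
      (fun y _ => (Dfun_deriv y).continuousAt.continuousWithinAt)
      (fun y _ => (Dfun_deriv y).differentiableAt.differentiableWithinAt) ?_
    intro y hy
    rw [interior_Ici] at hy
    rw [(Dfun_deriv y).deriv]
    have := hanti (Set.self_mem_Ici) (le_of_lt hy : ξ ≤ y) (le_of_lt hy)
    exact mul_nonpos_of_nonneg_of_nonpos (exp_pos _).le (by linarith)
  have hlim : Filter.Tendsto Dfun Filter.atTop (nhds 0) := by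
    have h1 : Filter.Tendsto (fun x : ℝ => exp (-x ^ 2 / 2)) Filter.atTop (nhds 0) := by
      have h3 : Filter.Tendsto (fun x : ℝ => x ^ 2 / 2) Filter.atTop Filter.atTop :=
        (Filter.tendsto_pow_atTop two_ne_zero).atTop_div_const two_pos
      refine (tendsto_exp_neg_atTop_nhds_zero.comp h3).congr fun x => ?_
      simp [neg_div]
    have h2 := h1.sub ((Phi_tendsto.mul (Phi_tendsto.const_sub 1)).const_mul 4)
    simp only [sub_self, mul_zero] at h2
    exact h2
  have hle : (0 : ℝ) ≤ Dfun x := by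
    refine le_of_tendsto hlim ?_
    filter_upwards [Filter.eventually_ge_atTop x] with y hy
    exact hDanti hξ.2.le (hξ.2.le.trans hy) hy
  linarith

lemma Dfun_nonneg (x : ℝ) : 0 ≤ Dfun x := by
  rcases le_total 0 x with h | h
  · exact Dfun_nonneg_of_nonneg x h
  · have := Dfun_nonneg_of_nonneg (-x) (by linarith)
    unfold Dfun at this ⊢
    rw [Phi_neg] at this
    simp only [neg_sq] at this
    linarith

lemma Phi_mul_le (x : ℝ) : (1 - Phi x) * Phi x ≤ exp (-x ^ 2 / 2) / 4 := by
  have := Dfun_nonneg x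
  unfold Dfun at this
  linarith

lemma abstract_bound (ν G : Measure ℝ) [IsProbabilityMeasure ν] [IsProbabilityMeasure G]
    (K : ℝ → ENNReal) (hK : Measurable K)
    (hG : G = ν.withDensity (fun u => ∫⁻ t, (Set.Iio u).indicator K t)) (ε : ENNReal)
    (hε : ∫⁻ t, K t * (ν (Set.Ioi t) * ν (Set.Iic t)) ≤ ε) (B : Set ℝ) (hB : MeasurableSet B) :
    G B ≤ ν B + ε := by
  have hmeas : ∀ B : Set ℝ, MeasurableSet B → Measurable fun t => ν (B ∩ Set.Ioi t) := by
    intro B hB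
    have : Antitone fun t => ν (B ∩ Set.Ioi t) := fun s t hst =>
      measure_mono (Set.inter_subset_inter_right _ (Set.Ioi_subset_Ioi hst))
    exact this.measurable
  have key : ∀ B : Set ℝ, MeasurableSet B → G B = ∫⁻ t, K t * ν (B ∩ Set.Ioi t) := by
    intro B hB
    rw [hG, withDensity_apply _ hB, lintegral_lintegral_swap]
    · refine lintegral_congr fun t => ?_
      have : ∀ u, (Set.Iio u).indicator K t = (Set.Ioi t).indicator (fun _ => K t) u := by
        intro u
        simp [Set.indicator]
      simp_rw [this]
      rw [lintegral_indicator measurableSet_Ioi, lintegral_const, Measure.restrict_restrict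
        measurableSet_Ioi, Measure.restrict_apply_univ, Set.inter_comm]
    · have : (Function.uncurry fun u t : ℝ => (Set.Iio u).indicator K t)
        = {p : ℝ × ℝ | p.2 < p.1}.indicator (fun p => K p.2) := by
        ext p; simp [Set.indicator, Function.uncurry]
      rw [this]
      exact ((hK.comp measurable_snd).indicator
        (measurableSet_lt measurable_snd measurable_fst)).aemeasurable
  have h1 : ∫⁻ t, K t * ν (Set.Ioi t) = 1 := by
    have := key Set.univ MeasurableSet.univ
    simpa using this.symm
  rw [key B hB]
  have hpt : ∀ t, ν (B ∩ Set.Ioi t) ≤ ν (Set.Ioi t) * ν B + ν (Set.Ioi t) * ν (Set.Iic t) := by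
    intro t
    have hs : ν (Set.Ioi t) + ν (Set.Iic t) = 1 := by
      have := measure_add_measure_compl (μ := ν) (measurableSet_Ioi (a := t))
      rwa [Set.compl_Ioi, measure_univ] at this
    calc ν (B ∩ Set.Ioi t) = ν (Set.Ioi t) * ν (B ∩ Set.Ioi t)
          + ν (B ∩ Set.Ioi t) * ν (Set.Iic t) := by
            rw [mul_comm (ν (Set.Ioi t)), ← mul_add, hs, mul_one]
      _ ≤ _ := by
        gcongr
        · exact Set.inter_subset_left
        · exact Set.inter_subset_right
  calc ∫⁻ t, K t * ν (B ∩ Set.Ioi t)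
      ≤ ∫⁻ t, (K t * ν (Set.Ioi t) * ν B + K t * (ν (Set.Ioi t) * ν (Set.Iic t))) := by
        refine lintegral_mono fun t => ?_
        calc K t * ν (B ∩ Set.Ioi t) ≤ K t * _ := mul_le_mul_right (hpt t) _
          _ = _ := by ring
    _ = ν B + ∫⁻ t, K t * (ν (Set.Ioi t) * ν (Set.Iic t)) := by
        have hm := hmeas Set.univ MeasurableSet.univ
        simp only [Set.univ_inter] at hm
        have hm2 : Measurable fun t => K t * ν (Set.Ioi t) := hK.mul hm
        rw [lintegral_add_left (hm2.mul_const _), lintegral_mul_const _ hm2, h1, one_mul]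
    _ ≤ _ := by gcongr

lemma abstract_tv (ν G : Measure ℝ) [IsProbabilityMeasure ν] [IsProbabilityMeasure G]
    (ε : ℝ) (hε : 0 ≤ ε) (h : ∀ B, MeasurableSet B → G B ≤ ν B + ENNReal.ofReal ε)
    (B : Set ℝ) (hB : MeasurableSet B) :
    |(G B).toReal - (ν B).toReal| ≤ ε := by
  have h' : ∀ B, MeasurableSet B → G.real B ≤ ν.real B + ε := by
    intro B hB
    have := ENNReal.toReal_mono (by simp) (h B hB)
    rwa [ENNReal.toReal_add (by simp) (by simp), ENNReal.toReal_ofReal hε] at this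
  have h1 := h' B hB
  have h2 := h' Bᶜ hB.compl
  rw [probReal_compl_eq_one_sub hB, probReal_compl_eq_one_sub hB] at h2
  simp only [measureReal_def] at h1 h2
  rw [abs_le]
  constructor <;> linarith

/-- The ratio of the gamma density to the matching normal density, for positive arguments. -/
def rfun (C a β u : ℝ) : ℝ := C * u ^ a * exp (-(β * u) + (β * u - a) ^ 2 / (2 * a))

lemma rfun_deriv (C a β u : ℝ) (ha : 0 < a) (hu : 0 < u) :
    HasDerivAt (rfun C a β) (rfun C a β u * ((β * u - a) ^ 2 / (a * u))) u := by
  have h1 := (hasDerivAt_rpow_const (p := a) (Or.inl hu.ne')).const_mul C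
  have h0 : HasDerivAt (fun u => β * u) β u := by
    simpa using (hasDerivAt_id u).const_mul β
  have h2 : HasDerivAt (fun u => -(β * u) + (β * u - a) ^ 2 / (2 * a))
      (-β + 2 * (β * u - a) * β / (2 * a)) u := by
    have := h0.neg.add (((h0.sub_const a).pow 2).div_const (2 * a))
    convert! this using 1
    simp
  have h3 := h1.mul h2.exp
  convert! h3 using 1
  unfold rfun
  rw [rpow_sub_one hu.ne']
  field_simp
  ring

lemma rfun_lintegral (C a β u : ℝ) (hC : 0 ≤ C) (ha : 0 < a) (hu : 0 ≤ u) :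
    ∫⁻ t in Set.Ioo 0 u, ENNReal.ofReal (rfun C a β t * ((β * t - a) ^ 2 / (a * t)))
      = ENNReal.ofReal (rfun C a β u) := by
  have hcont : ContinuousOn (rfun C a β) (Set.Icc 0 u) := by
    have : Continuous (rfun C a β) := by
      unfold rfun
      have := continuous_rpow_const ha.le
      fun_prop
    exact this.continuousOn
  have hd : ∀ x ∈ Set.Ioo 0 u, HasDerivAt (rfun C a β)
      (rfun C a β x * ((β * x - a) ^ 2 / (a * x))) x :=
    fun x hx => rfun_deriv C a β x ha hx.1
  have hpos : ∀ x ∈ Set.Ioo 0 u, 0 ≤ rfun C a β x * ((β * x - a) ^ 2 / (a * x)) := by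
    intro x hx
    have := hx.1
    unfold rfun
    positivity
  have hint := intervalIntegral.integrableOn_deriv_of_nonneg hcont hd hpos
  have hftc := intervalIntegral.integral_eq_sub_of_hasDerivAt_of_le hu hcont hd
    ((intervalIntegrable_iff_integrableOn_Ioc_of_le hu).2 hint)
  rw [← ofReal_integral_eq_lintegral_ofReal (hint.mono_set Set.Ioo_subset_Ioc_self)
    ((ae_restrict_iff' measurableSet_Ioo).2 (ae_of_all _ hpos)), ← integral_Ioc_eq_integral_Ioo,
    ← intervalIntegral.integral_of_le hu, hftc]
  simp [rfun, zero_rpow ha.ne']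

/-- Exact second-order moment. -/
lemma moment (a β : ℝ) (ha : 0 < a) (hβ : 0 < β) :
    ∫⁻ t in Set.Ioi 0, ENNReal.ofReal
      (β ^ (a + 1) / Gamma (a + 1) * t ^ a * exp (-(β * t)) * ((β * t - a) ^ 2 / (a * t)))
      = ENNReal.ofReal (β / a) := by
  have hG : 0 < Gamma (a + 1) := Gamma_pos_of_pos (by linarith)
  have hint : ∀ s : ℝ, 0 < s →
      IntegrableOn (fun t : ℝ => t ^ (s - 1) * exp (-(β * t))) (Set.Ioi 0) := by
    intro s hs
    have := integrableOn_rpow_mul_exp_neg_mul_rpow (p := 1) (s := s - 1) (b := β) (by linarith)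
      one_pos hβ
    simpa using this
  have i1 := hint a ha
  have i2 := hint (a + 1) (by linarith)
  have i3 := hint (a + 2) (by linarith)
  have e1 := integral_rpow_mul_exp_neg_mul_Ioi ha hβ
  have e2 := integral_rpow_mul_exp_neg_mul_Ioi (a := a + 1) (by linarith) hβ
  have e3 := integral_rpow_mul_exp_neg_mul_Ioi (a := a + 2) (by linarith) hβ
  set c := β ^ (a + 1) / Gamma (a + 1) with hc
  have hc0 : 0 < c := by positivity
  have heq : ∀ t ∈ Set.Ioi (0:ℝ),
      c * (β ^ 2 / a * (t ^ (a + 2 - 1) * exp (-(β * t)))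
        - 2 * β * (t ^ (a + 1 - 1) * exp (-(β * t))) + a * (t ^ (a - 1) * exp (-(β * t))))
      = c * t ^ a * exp (-(β * t)) * ((β * t - a) ^ 2 / (a * t)) := by
    intro t ht
    have ht : 0 < t := ht
    have h1 : t ^ (a + 2 - 1) = t ^ a * t := by
      rw [show a + 2 - 1 = a + 1 by ring, rpow_add_one ht.ne']
    rw [h1, add_sub_cancel_right, rpow_sub_one ht.ne']
    field_simp
    ring
  have hI := (((i3.const_mul (β ^ 2 / a)).sub (i2.const_mul (2 * β))).add
    (i1.const_mul a)).const_mul c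
  have hI' : IntegrableOn (fun t => c * t ^ a * exp (-(β * t)) * ((β * t - a) ^ 2 / (a * t)))
      (Set.Ioi 0) := by
    refine IntegrableOn.congr_fun hI ?_ measurableSet_Ioi
    intro t ht
    exact heq t ht
  rw [← ofReal_integral_eq_lintegral_ofReal hI']
  · congr 1
    have hsub : IntegrableOn (fun t : ℝ => β ^ 2 / a * (t ^ (a + 2 - 1) * exp (-(β * t)))
        - 2 * β * (t ^ (a + 1 - 1) * exp (-(β * t)))) (Set.Ioi 0) :=
      (i3.const_mul (β ^ 2 / a)).sub (i2.const_mul (2 * β))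
    rw [← setIntegral_congr_fun measurableSet_Ioi heq, integral_const_mul,
      integral_add hsub (i1.const_mul a),
      integral_sub (i3.const_mul (β ^ 2 / a)) (i2.const_mul (2 * β)),
      integral_const_mul, integral_const_mul, integral_const_mul, e1, e2, e3]
    have g2 : Gamma (a + 2) = (a + 1) * (a * Gamma a) := by
      rw [show a + 2 = (a + 1) + 1 by ring, Gamma_add_one (by linarith), Gamma_add_one ha.ne']
    have ga := Gamma_pos_of_pos ha
    have hb := rpow_pos_of_pos hβ a
    have p2 : (1 / β) ^ (a + 2) = (β ^ a)⁻¹ / β ^ 2 := by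
      rw [rpow_add (by positivity), one_div, inv_rpow hβ.le]
      norm_num
      rfl
    have p1 : (1 / β) ^ (a + 1) = (β ^ a)⁻¹ / β := by
      rw [rpow_add_one (by positivity), one_div, inv_rpow hβ.le]
      rfl
    have p0 : (1 / β) ^ a = (β ^ a)⁻¹ := by
      rw [one_div, inv_rpow hβ.le]
    rw [hc, p2, p1, p0, g2, Gamma_add_one ha.ne', rpow_add_one hβ.ne']
    field_simp
    ring
  · refine (ae_restrict_iff' measurableSet_Ioi).2 (ae_of_all _ fun t ht => ?_)
    have ht : 0 < t := ht
    simp only [Pi.zero_apply]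
    positivity

lemma core_s18 (a β : ℝ) (ha : 0 < a) (hβ : 0 < β) (v : NNReal) (hv : (v : ℝ) = a / β ^ 2)
    (B : Set ℝ) (hB : MeasurableSet B) :
    (gaussianReal (a / β) v).map (fun x => β / √a * (x - a / β)) = gaussianReal 0 1 ∧
    |(gammaMeasure (a + 1) β B).toReal - (gaussianReal (a / β) v B).toReal| ≤
      √(π / (8 * a)) := by
  have hv0 : v ≠ 0 := by
    intro h
    rw [h] at hv
    have : 0 < a / β ^ 2 := by positivity
    rw [← hv] at this
    simp at this
  have hsa : 0 < √a := sqrt_pos.2 ha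
  have hsa2 : √a ^ 2 = a := sq_sqrt ha.le
  have hmap : (gaussianReal (a / β) v).map (fun x => β / √a * (x - a / β)) = gaussianReal 0 1 := by
    have : (fun x => β / √a * (x - a / β)) = (fun x => β / √a * x) ∘ (fun x => x - a / β) := rfl
    rw [this, ← Measure.map_map (by fun_prop) (by fun_prop), gaussianReal_map_sub_const,
      gaussianReal_map_const_mul]
    congr 1
    · simp
    · apply NNReal.eq
      simp only [NNReal.coe_mul, NNReal.coe_mk, hv, NNReal.coe_one]
      rw [div_pow, hsa2]
      field_simp
  refine ⟨hmap, ?_⟩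
  have hGam : 0 < Gamma (a + 1) := Gamma_pos_of_pos (by linarith)
  obtain ⟨c, hc⟩ : ∃ c, c = β ^ (a + 1) / Gamma (a + 1) := ⟨_, rfl⟩
  obtain ⟨s, hs⟩ : ∃ s, s = √(2 * π * v) := ⟨_, rfl⟩
  have hc0 : 0 < c := by rw [hc]; positivity
  have hs0 : 0 < s := by rw [hs, hv]; positivity
  have hprod : ∀ t, rfun (c * s) a β t * exp (-((β * t - a) ^ 2 / (2 * a)))
      = s * (c * t ^ a * exp (-(β * t))) := by
    intro t
    unfold rfun
    rw [exp_add, exp_neg ((β * t - a) ^ 2 / (2 * a))]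
    have := (exp_pos ((β * t - a) ^ 2 / (2 * a))).ne'
    field_simp
  have hgpdf : ∀ t, gaussianPDFReal (a / β) v t
      = s⁻¹ * exp (-((β * t - a) ^ 2 / (2 * a))) := by
    intro t
    rw [gaussianPDFReal, ← hs, hv]
    congr 2
    field_simp
  have := isProbabilityMeasure_gammaMeasure (a := a + 1) (r := β) (by linarith) hβ
  let K : ℝ → ENNReal := (Set.Ioi 0).indicator fun t =>
    ENNReal.ofReal (rfun (c * s) a β t * ((β * t - a) ^ 2 / (a * t)))
  have hr : Measurable (rfun (c * s) a β) := by unfold rfun; fun_prop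
  have hK : Measurable K := by
    refine Measurable.indicator ?_ measurableSet_Ioi
    fun_prop
  have hρ : (fun u => ∫⁻ t, (Set.Iio u).indicator K t)
      = (Set.Ici 0).indicator fun u => ENNReal.ofReal (rfun (c * s) a β u) := by
    ext u
    simp only [K]
    rw [Set.indicator_indicator, lintegral_indicator (measurableSet_Iio.inter measurableSet_Ioi),
      Set.inter_comm, Set.Ioi_inter_Iio]
    by_cases hu : 0 ≤ u
    · rw [rfun_lintegral _ _ _ _ (by positivity) ha hu]
      simp [hu]
    · rw [Set.Ioo_eq_empty (by linarith)]
      simp [hu]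
  have hG : gammaMeasure (a + 1) β
      = (gaussianReal (a / β) v).withDensity (fun u => ∫⁻ t, (Set.Iio u).indicator K t) := by
    rw [hρ, gaussianReal_of_var_ne_zero _ hv0, gammaMeasure, ← withDensity_mul _
      (measurable_gaussianPDF _ _) (Measurable.indicator (by fun_prop) measurableSet_Ici)]
    congr 1
    ext u
    by_cases hu : 0 ≤ u
    · rw [gammaPDF_of_nonneg hu, Pi.mul_apply, gaussianPDF,
        Set.indicator_of_mem (Set.mem_Ici.2 hu), ← ENNReal.ofReal_mul (gaussianPDFReal_nonneg _ _ _),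
        hgpdf, mul_assoc s⁻¹, mul_comm (exp (-((β * u - a) ^ 2 / (2 * a)))), hprod, ← hc,
        add_sub_cancel_right]
      congr 1
      field_simp
    · rw [gammaPDF_of_neg (by linarith)]
      simp [hu]
  have hN : ∀ t, gaussianReal (a / β) v (Set.Ioi t) * gaussianReal (a / β) v (Set.Iic t)
      ≤ ENNReal.ofReal (exp (-((β * t - a) ^ 2 / (2 * a))) / 4) := by
    intro t
    have hk : 0 < β / √a := by positivity
    have e1 : gaussianReal (a / β) v (Set.Ioi t)
        = gaussianReal 0 1 (Set.Ioi (β / √a * (t - a / β))) := by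
      rw [← hmap, Measure.map_apply (by fun_prop) measurableSet_Ioi]
      congr 1; ext y
      simp only [Set.mem_Ioi, Set.mem_preimage]
      rw [mul_lt_mul_iff_right₀ hk, sub_lt_sub_iff_right]
    have e2 : gaussianReal (a / β) v (Set.Iic t)
        = gaussianReal 0 1 (Set.Iic (β / √a * (t - a / β))) := by
      rw [← hmap, Measure.map_apply (by fun_prop) measurableSet_Iic]
      congr 1; ext y
      simp only [Set.mem_Iic, Set.mem_preimage]
      rw [mul_le_mul_iff_right₀ hk, sub_le_sub_iff_right]
    have h := Phi_mul_le (β / √a * (t - a / β))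
    rw [← Phi_compl, Phi] at h
    have h4 : -(β / √a * (t - a / β)) ^ 2 / 2 = -((β * t - a) ^ 2 / (2 * a)) := by
      rw [mul_pow, div_pow, hsa2]
      field_simp
    rw [h4] at h
    rw [e1, e2]
    refine (ENNReal.le_ofReal_iff_toReal_le (ENNReal.mul_ne_top (by simp) (by simp))
      (by positivity)).2 ?_
    rw [ENNReal.toReal_mul]
    exact h
  refine abstract_tv _ _ _ (sqrt_nonneg _) (fun B hB => ?_) B hB
  refine abstract_bound _ _ K hK hG _ ?_ B hB
  have hs2 : s ^ 2 = 2 * π * (a / β ^ 2) := by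
    rw [hs, hv, sq_sqrt (by positivity)]
  have hfin : s / 4 * (β / a) = √(π / (8 * a)) := by
    symm
    rw [sqrt_eq_iff_eq_sq (by positivity) (by positivity), mul_pow, div_pow, hs2]
    field_simp
    norm_num
  calc ∫⁻ t, K t * (gaussianReal (a / β) v (Set.Ioi t) * gaussianReal (a / β) v (Set.Iic t))
      ≤ ∫⁻ t, (Set.Ioi 0).indicator (fun t => ENNReal.ofReal (s / 4) * ENNReal.ofReal
        (β ^ (a + 1) / Gamma (a + 1) * t ^ a * exp (-(β * t)) * ((β * t - a) ^ 2 / (a * t)))) t := by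
        refine lintegral_mono fun t => ?_
        by_cases ht : 0 < t
        · simp only [K]
          rw [Set.indicator_of_mem (Set.mem_Ioi.2 ht), Set.indicator_of_mem (Set.mem_Ioi.2 ht)]
          refine (mul_le_mul_right (hN t) _).trans (le_of_eq ?_)
          rw [← ENNReal.ofReal_mul (by unfold rfun; positivity), ← ENNReal.ofReal_mul (by positivity)]
          congr 1
          have := hprod t
          rw [← hc]
          linear_combination ((β * t - a) ^ 2 / (a * t)) / 4 * this
        · simp [K, ht]
    _ = ENNReal.ofReal (√(π / (8 * a))) := by
        rw [lintegral_indicator measurableSet_Ioi, lintegral_const_mul _ (by fun_prop),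
          moment a β ha hβ, ← ENNReal.ofReal_mul (by positivity), hfin]
    _ ≤ _ := le_rfl



/-- Total variation bound for the mode-standardised gamma
distribution: if `X ~ Gamma(α, β)` with `α > 1`, `β > 0`, and
`X* = (β/√(α−1))(X − (α−1)/β)`, then `d_TV(X*, N) ≤ √(π/(8(α−1)))`. -/
theorem tv_bound_gamma_mode
    (α β : ℝ) (hα : 1 < α) (hβ : 0 < β)
    {Ω : Type*} [MeasurableSpace Ω] (P : Measure Ω) [IsProbabilityMeasure P]
    (X : Ω → ℝ) (hXmeas : Measurable X)
    (hlaw : Measure.map X P = gammaMeasure α β)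
    (Xstar : Ω → ℝ)
    (hXstar : ∀ ω, Xstar ω = β / Real.sqrt (α - 1) * (X ω - (α - 1) / β)) :
    ∀ A : Set ℝ, MeasurableSet A →
      |(P (Xstar ⁻¹' A)).toReal - (gaussianReal 0 1 A).toReal| ≤
        Real.sqrt (π / (8 * (α - 1))) := by
  intro A hA
  have ha : 0 < α - 1 := by linarith
  obtain ⟨a, rfl⟩ : ∃ a, α = a + 1 := ⟨α - 1, by ring⟩
  simp only [add_sub_cancel_right] at ha hXstar ⊢
  have hT : Measurable fun x : ℝ => β / √a * (x - a / β) := by fun_prop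
  have hcore := core_s18 a β ha hβ ⟨a / β ^ 2, by positivity⟩ rfl
    ((fun x : ℝ => β / √a * (x - a / β)) ⁻¹' A) (hT hA)
  have h2 := hcore.2
  rw [← hlaw, Measure.map_apply hXmeas (hT hA), ← Measure.map_apply hT hA, hcore.1] at h2
  have : Xstar ⁻¹' A = X ⁻¹' ((fun x : ℝ => β / √a * (x - a / β)) ⁻¹' A) := by
    ext ω; simp [hXstar]
  rw [this]
  exact h2
end
end

section
/- Exact Wasserstein distance between a gamma distribution and its mode-matched normal approximation: let α > 1 and β > 0, let X be a random variable with the Gamma(α, β) distribution (density β^α w^{α−1} e^{−βw}/Γ(α) for w > 0), and let Y ~ N((α−1)/β, (α−1)/β²) be a normal random variable with mean (α−1)/β and variance (α−1)/β². Then d_Wass(X, Y) = 1/β. -/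
open MeasureTheory Real ProbabilityTheory

noncomputable section

/-- One crossing of the densities implies stochastic ordering. -/
lemma aux_single_crossing (p q f : ℝ → ℝ) (hp : Integrable p) (hq : Integrable q)
    (hpq : ∫ x, p x = ∫ x, q x) (hlow : ∀ x y, x ≤ y → p y ≤ q y → p x ≤ q x)
    (hne : ∃ x, p x ≤ q x) (hf : Monotone f)
    (hfp : Integrable fun x => p x * f x) (hfq : Integrable fun x => q x * f x) :
    ∫ x, q x * f x ≤ ∫ x, p x * f x := by
  by_cases hb : BddAbove {x | p x ≤ q x}
  · set c := sSup {x | p x ≤ q x} with hc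
    have key : 0 ≤ ∫ x, (p x * f x - q x * f x) - f c * (p x - q x) := by
      apply integral_nonneg
      intro x
      have e : (p x * f x - q x * f x) - f c * (p x - q x) = (f x - f c) * (p x - q x) := by ring
      simp only [Pi.zero_apply, e]
      rcases lt_trichotomy x c with h | h | h
      · obtain ⟨y, hy, hxy⟩ := exists_lt_of_lt_csSup hne h
        have h1 := hlow x y hxy.le hy
        exact mul_nonneg_of_nonpos_of_nonpos (by linarith [hf h.le]) (by linarith)
      · simp [h]
      · have h1 : ¬ p x ≤ q x := fun h2 => absurd (le_csSup hb h2) (not_le.mpr h)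
        exact mul_nonneg (by linarith [hf h.le]) (by linarith)
    have i1 : Integrable fun x => p x * f x - q x * f x := hfp.sub hfq
    have i2 : Integrable fun x => f c * (p x - q x) := (hp.sub hq).const_mul _
    rw [integral_sub i1 i2, integral_const_mul,
      integral_sub hfp hfq, integral_sub hp hq, hpq] at key
    linarith
  · have hall : ∀ x, p x ≤ q x := by
      intro x
      rw [not_bddAbove_iff] at hb
      obtain ⟨y, hy, hxy⟩ := hb x
      exact hlow x y hxy.le hy
    have h0 : ∫ x, (q x - p x) = 0 := by rw [integral_sub hq hp, hpq, sub_self]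
    have h1 := (integral_eq_zero_iff_of_nonneg (fun x => sub_nonneg.mpr (hall x))
      (hq.sub hp)).mp h0
    apply le_of_eq
    apply integral_congr_ae
    filter_upwards [h1] with x hx
    have : q x = p x := by simpa [sub_eq_zero] using hx
    simp [this]

lemma aux_log_mono {s t : ℝ} (hs : 0 < s) (hst : s ≤ t) :
    log s - 2 * s + s ^ 2 / 2 ≤ log t - 2 * t + t ^ 2 / 2 := by
  have hd : ∀ x ∈ Set.Ioi (0:ℝ), HasDerivAt (fun x : ℝ => log x - 2 * x + x ^ 2 / 2)
      (x⁻¹ - 2 * 1 + (2 * x) / 2) x := by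
    intro x hx
    have h := ((hasDerivAt_log (ne_of_gt hx)).sub ((hasDerivAt_id x).const_mul 2)).add
      ((hasDerivAt_pow 2 x).div_const 2)
    have e : x⁻¹ - 2 * 1 + (2 * x) / 2 = x⁻¹ - 2 * 1 + ((2 : ℕ) : ℝ) * x ^ (2 - 1) / 2 := by
      norm_num
    rw [e]
    exact h
  have hm : MonotoneOn (fun x : ℝ => log x - 2 * x + x ^ 2 / 2) (Set.Ioi 0) := by
    apply monotoneOn_of_deriv_nonneg (convex_Ioi 0)
    · exact fun x hx => (hd x hx).continuousAt.continuousWithinAt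
    · rw [interior_Ioi]
      exact fun x hx => (hd x hx).differentiableAt.differentiableWithinAt
    · rw [interior_Ioi]
      intro x hx
      rw [(hd x hx).deriv]
      have hx' : 0 < x := hx
      have : x⁻¹ - 2 * 1 + (2 * x) / 2 = (x - 1) ^ 2 / x := by field_simp; ring
      rw [this]; positivity
  exact hm hs (lt_of_lt_of_le hs hst) hst

lemma aux_exponent {k β x y : ℝ} (hk : 0 < k) (hβ : 0 < β) (hx : 0 < x) (hxy : x ≤ y) :
    k * log x + (-(β * x)) + -(y - k / β) ^ 2 / (2 * (k / β ^ 2)) ≤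
    k * log y + (-(β * y)) + -(x - k / β) ^ 2 / (2 * (k / β ^ 2)) := by
  have hy : 0 < y := hx.trans_le hxy
  have h := aux_log_mono (s := β * x / k) (t := β * y / k) (by positivity) (by gcongr)
  rw [log_div (by positivity) hk.ne', log_div (by positivity) hk.ne',
    log_mul hβ.ne' hx.ne', log_mul hβ.ne' hy.ne'] at h
  have h2 := mul_le_mul_of_nonneg_left h hk.le
  have ex : ∀ z : ℝ, -(z - k / β) ^ 2 / (2 * (k / β ^ 2)) =
      k * (-(β * z / k) ^ 2 / 2) + β * z - k / 2 := by
    intro z; field_simp; ring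
  have ez : ∀ z : ℝ, k * (β * z / k) = β * z := by intro z; field_simp
  rw [ex x, ex y]
  have := ez x
  have := ez y
  nlinarith

lemma aux_gamma_integrable {a r : ℝ} (ha : 0 < a) (hr : 0 < r) :
    Integrable (gammaPDFReal a r) := by
  refine ⟨(stronglyMeasurable_gammaPDFReal a r).aestronglyMeasurable, ?_⟩
  rw [hasFiniteIntegral_iff_ofReal (ae_of_all _ (gammaPDFReal_nonneg ha hr))]
  have := lintegral_gammaPDF_eq_one ha hr
  simp only [gammaPDF] at this
  rw [this]; simp

lemma aux_gamma_integral {a r : ℝ} (ha : 0 < a) (hr : 0 < r) :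
    ∫ x, gammaPDFReal a r x = 1 := by
  rw [integral_eq_lintegral_of_nonneg_ae (ae_of_all _ (gammaPDFReal_nonneg ha hr))
    (stronglyMeasurable_gammaPDFReal a r).aestronglyMeasurable]
  have := lintegral_gammaPDF_eq_one ha hr
  simp only [gammaPDF] at this
  rw [this]; simp

lemma aux_gamma_mul {a r : ℝ} (ha : 0 < a) (hr : 0 < r) (x : ℝ) :
    gammaPDFReal a r x * x = a / r * gammaPDFReal (a + 1) r x := by
  unfold gammaPDFReal
  split_ifs with h
  · have h1 : x ^ (a - 1) * x = x ^ a := by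
      rcases h.eq_or_lt with h | h
      · rw [← h, zero_rpow ha.ne', mul_zero]
      · rw [rpow_sub_one h.ne']; field_simp
    have hG := (Gamma_pos_of_pos ha).ne'
    rw [Gamma_add_one ha.ne', rpow_add_one hr.ne', add_sub_cancel_right, ← h1]
    field_simp
  · simp

lemma aux_gamma_eq (a r : ℝ) (ha : 0 < a) (hr : 0 < r) (f : ℝ → ℝ) :
    ∫ x, f x ∂(gammaMeasure a r) = ∫ x, gammaPDFReal a r x * f x := by
  unfold gammaMeasure gammaPDF
  rw [integral_withDensity_eq_integral_toReal_smul (by fun_prop) (by simp)]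
  congr 1; ext x
  rw [ENNReal.toReal_ofReal (gammaPDFReal_nonneg ha hr x), smul_eq_mul]

lemma aux_integrable {p f : ℝ → ℝ} (hp : Integrable p) (hpx : Integrable fun x => p x * x)
    (hf : LipschitzWith 1 f) : Integrable fun x => p x * f x := by
  refine Integrable.mono' ((hp.norm.mul_const |f 0|).add hpx.norm)
    (hp.aestronglyMeasurable.mul hf.continuous.aestronglyMeasurable) (ae_of_all _ fun x => ?_)
  have h := hf.dist_le_mul x 0
  simp only [Real.dist_eq, NNReal.coe_one, one_mul, sub_zero] at h
  have h2 : |f x| ≤ |f 0| + |x| := by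
    have := abs_sub_abs_le_abs_sub (f x) (f 0)
    linarith
  simp only [norm_mul, Real.norm_eq_abs, Pi.add_apply]
  nlinarith [abs_nonneg (p x)]

/-- Exact Wasserstein distance between a gamma distribution and
its mode-matched normal approximation: for `α > 1`, `β > 0`, if
`X ~ Gamma(α, β)` and `Y ~ N((α−1)/β, (α−1)/β²)`, then `d_Wass(X, Y) = 1/β`,
where `d_Wass` is the supremum of `|E h(X) − E h(Y)|` over 1-Lipschitz `h`. -/
theorem wass_gamma_normal_exact
    (α β : ℝ) (hα : 1 < α) (hβ : 0 < β) :
    (⨆ h : {h : ℝ → ℝ // LipschitzWith 1 h},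
      |(∫ x, h.1 x ∂(gammaMeasure α β)) -
        ∫ x, h.1 x ∂(gaussianReal ((α - 1) / β) (Real.toNNReal ((α - 1) / β ^ 2)))|)
      = 1 / β := by
  have hk : 0 < α - 1 := by linarith
  have hα0 : 0 < α := by linarith
  have hvpos : 0 < (α - 1) / β ^ 2 := by positivity
  set v := Real.toNNReal ((α - 1) / β ^ 2) with hv
  have hvc : (v : ℝ) = (α - 1) / β ^ 2 := Real.coe_toNNReal _ hvpos.le
  have hv0 : v ≠ 0 := by
    intro h; rw [h] at hvc; simp only [NNReal.coe_zero] at hvc; linarith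
  set m := (α - 1) / β with hm
  set p := gammaPDFReal α β with hpdef
  set q := gaussianPDFReal m v with hqdef
  have hG : ∀ f : ℝ → ℝ, ∫ x, f x ∂(gaussianReal m v) = ∫ x, q x * f x := by
    intro f
    rw [integral_gaussianReal_eq_integral_smul hv0]; rfl
  have hP : ∀ f : ℝ → ℝ, ∫ x, f x ∂(gammaMeasure α β) = ∫ x, p x * f x :=
    fun f => aux_gamma_eq α β hα0 hβ f
  have hp : Integrable p := aux_gamma_integrable hα0 hβ
  have hq : Integrable q := integrable_gaussianPDFReal m v
  have hpx : Integrable fun x => p x * x := by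
    simp only [hpdef, aux_gamma_mul hα0 hβ]
    exact (aux_gamma_integrable (by linarith) hβ).const_mul _
  have hpm : ∫ x, p x * x = α / β := by
    simp only [hpdef, aux_gamma_mul hα0 hβ]
    rw [integral_const_mul, aux_gamma_integral (by linarith) hβ, mul_one]
  have hqx : Integrable fun x => q x * x := by
    have h1 : Integrable (fun x : ℝ => x) (gaussianReal m v) :=
      (memLp_id_gaussianReal (μ := m) (v := v) 1).integrable le_rfl
    rw [gaussianReal_of_var_ne_zero _ hv0] at h1
    rw [integrable_withDensity_iff_integrable_smul' (measurable_gaussianPDF m v)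
      (ae_of_all _ fun x => gaussianPDF_lt_top)] at h1
    simpa [toReal_gaussianPDF] using h1
  have hqm : ∫ x, q x * x = m := by
    rw [← hG]; exact integral_id_gaussianReal
  have hpq : ∫ x, p x = ∫ x, q x := by
    rw [hpdef, hqdef, aux_gamma_integral hα0 hβ, integral_gaussianPDFReal_eq_one m hv0]
  have hqpos : ∀ x, 0 < q x := fun x => gaussianPDFReal_pos m v x hv0
  have hpneg : ∀ x ≤ 0, p x = 0 := by
    intro x hx
    simp only [hpdef, gammaPDFReal]
    split_ifs with h
    · have : x = 0 := le_antisymm hx h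
      rw [this, zero_rpow hk.ne']; simp
    · rfl
  have hlr : ∀ x y, 0 < x → x ≤ y → p x * q y ≤ p y * q x := by
    intro x y hx hxy
    have hy : 0 < y := hx.trans_le hxy
    simp only [hpdef, hqdef, gammaPDFReal, gaussianPDFReal, if_pos hx.le, if_pos hy.le, hvc]
    have hE := exp_le_exp.mpr (aux_exponent hk hβ hx hxy)
    rw [exp_add, exp_add, exp_add, exp_add, mul_comm _ (log x), mul_comm _ (log y),
      ← rpow_def_of_pos hx, ← rpow_def_of_pos hy] at hE
    have hC : 0 ≤ β ^ α / Gamma α * (√(2 * π * ((α - 1) / β ^ 2)))⁻¹ := by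
      have := Gamma_pos_of_pos hα0
      positivity
    have := mul_le_mul_of_nonneg_left hE hC
    rw [← hm] at this
    linarith
  have hlow : ∀ x y, x ≤ y → p y ≤ q y → p x ≤ q x := by
    intro x y hxy h
    rcases le_or_gt x 0 with hx | hx
    · rw [hpneg x hx]; exact (hqpos x).le
    · have h1 := hlr x y hx hxy
      have h2 := mul_le_mul_of_nonneg_right h (hqpos x).le
      have h3 : p x * q y ≤ q x * q y := by linarith
      exact le_of_mul_le_mul_right h3 (hqpos y)
  have hdom : ∀ f : ℝ → ℝ, Monotone f → Integrable (fun x => p x * f x) →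
      Integrable (fun x => q x * f x) → ∫ x, q x * f x ≤ ∫ x, p x * f x := fun f hf h1 h2 =>
    aux_single_crossing p q f hp hq hpq hlow ⟨0, by rw [hpneg 0 le_rfl]; exact (hqpos 0).le⟩
      hf h1 h2
  have hdiff : α / β - m = 1 / β := by rw [hm]; field_simp; ring
  have hub : ∀ h : {h : ℝ → ℝ // LipschitzWith 1 h},
      |(∫ x, h.1 x ∂(gammaMeasure α β)) - ∫ x, h.1 x ∂(gaussianReal m v)| ≤ 1 / β := by
    rintro ⟨f, hf⟩
    simp only [hP, hG]
    have hfp := aux_integrable hp hpx hf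
    have hfq := aux_integrable hq hqx hf
    have hl : ∀ x y, x ≤ y → |f y - f x| ≤ y - x := by
      intro x y hxy
      have h := hf.dist_le_mul y x
      simpa [Real.dist_eq, abs_of_nonneg (sub_nonneg.mpr hxy)] using h
    have e1 := hdom (fun x => x + f x)
      (fun x y hxy => by have := abs_le.mp (hl x y hxy); simp only; linarith)
      (by simp only [mul_add]; exact hpx.add hfp) (by simp only [mul_add]; exact hqx.add hfq)
    have e2 := hdom (fun x => x - f x)
      (fun x y hxy => by have := abs_le.mp (hl x y hxy); simp only; linarith)
      (by simp only [mul_sub]; exact hpx.sub hfp) (by simp only [mul_sub]; exact hqx.sub hfq)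
    simp only [mul_add, mul_sub] at e1 e2
    rw [integral_add hqx hfq, integral_add hpx hfp, hpm, hqm] at e1
    rw [integral_sub hqx hfq, integral_sub hpx hfp, hpm, hqm] at e2
    rw [abs_le]
    constructor <;> linarith
  have : Nonempty {h : ℝ → ℝ // LipschitzWith 1 h} := ⟨⟨id, LipschitzWith.id⟩⟩
  apply le_antisymm (ciSup_le hub)
  refine le_ciSup_of_le ⟨1 / β, by rintro _ ⟨h, rfl⟩; exact hub h⟩ ⟨id, LipschitzWith.id⟩ ?_
  simp only [hP, hG, id]
  rw [hpm, hqm, hdiff]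
  exact le_abs_self _
end
end
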